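/- arXiv:2407.03309 — 9 statements merged into one kernel-verified Lean document; each statement's English description precedes it below -/
import Mathlib

section
/- Let M be a real symmetric n×n matrix with Trace(M) ≥ 0, whose eigenvalues (with multiplicity) consist of exactly one positive eigenvalue, exactly r−1 negative eigenvalues, and exactly n−r zero eigenvalues, where 2 ≤ r ≤ n. Write CharPoly_M(x) = Σ_{k=0}^n a_k x^k. If Trace(M) = 0, then a_k < 0 for all k with n−r ≤ k ≤ n−2; and if Trace(M) > 0, then a_k < 0 for all k with n−r ≤ k ≤ n−1. -/
open Polynomial

/-- The coefficients of a monic polynomial `Q = ∏ (X - l i)` with negative roots are positive, and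
consecutive ones satisfy `Q_k ≤ (-∑ l i) * Q_{k+1}`, strictly so below the top pair. -/
theorem coeff_prod_X_sub_C_of_neg {ι : Type*} (l : ι → ℝ) (S : Finset ι) (hl : ∀ i ∈ S, l i < 0) :
    (∀ k, 0 ≤ (∏ i ∈ S, (X - C (l i))).coeff k) ∧
    (∀ k ≤ S.card, 0 < (∏ i ∈ S, (X - C (l i))).coeff k) ∧
    (∀ k < S.card, (∏ i ∈ S, (X - C (l i))).coeff k ≤
      (-∑ i ∈ S, l i) * (∏ i ∈ S, (X - C (l i))).coeff (k + 1)) ∧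
    (∀ k, k + 1 < S.card → (∏ i ∈ S, (X - C (l i))).coeff k <
      (-∑ i ∈ S, l i) * (∏ i ∈ S, (X - C (l i))).coeff (k + 1)) := by
  classical
  induction S using Finset.induction_on with
  | empty =>
    refine ⟨fun k => ?_, fun k hk => ?_, fun k hk => ?_, fun k hk => ?_⟩
    · simp only [Finset.prod_empty, coeff_one]
      split_ifs <;> norm_num
    · simp_all
    · simp at hk
    · simp at hk
  | insert a S ha ih =>
    obtain ⟨hnn, hpos, hle, -⟩ := ih fun i hi => hl i (Finset.mem_insert_of_mem hi)
    have hb : 0 < -l a := neg_pos.2 (hl a (Finset.mem_insert_self a S))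
    have hs : 0 ≤ -∑ i ∈ S, l i :=
      neg_nonneg.2 (Finset.sum_nonpos fun i hi => (hl i (Finset.mem_insert_of_mem hi)).le)
    rw [Finset.prod_insert ha, Finset.sum_insert ha, Finset.card_insert_of_notMem ha]
    set Q := ∏ i ∈ S, (X - C (l i))
    set s := ∑ i ∈ S, l i
    have hzero : ((X - C (l a)) * Q).coeff 0 = -l a * Q.coeff 0 := by
      simp [sub_mul]
    have hsucc (k : ℕ) :
        ((X - C (l a)) * Q).coeff (k + 1) = Q.coeff k + -l a * Q.coeff (k + 1) := by
      rw [sub_mul, coeff_sub, coeff_X_mul, coeff_C_mul]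
      ring
    have hgap (k : ℕ) (hk : k < S.card + 1) : ((X - C (l a)) * Q).coeff k +
        (-l a) ^ 2 * Q.coeff (k + 1) ≤
          -(l a + s) * ((X - C (l a)) * Q).coeff (k + 1) := by
      rw [hsucc]
      have hcross := mul_nonneg (mul_nonneg hs hb.le) (hnn (k + 1))
      cases k with
      | zero =>
        rw [hzero]
        nlinarith [mul_nonneg hs (hnn 0)]
      | succ j =>
        rw [hsucc]
        nlinarith [hle j (by lia)]
    refine ⟨fun k => ?_, fun k hk => ?_, fun k hk => ?_, fun k hk => ?_⟩
    · cases k with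
      | zero => rw [hzero]; exact mul_nonneg hb.le (hnn 0)
      | succ j => rw [hsucc]; exact add_nonneg (hnn j) (mul_nonneg hb.le (hnn _))
    · cases k with
      | zero => rw [hzero]; exact mul_pos hb (hpos 0 (by lia))
      | succ j =>
        rw [hsucc]
        exact add_pos_of_pos_of_nonneg (hpos j (by lia)) (mul_nonneg hb.le (hnn _))
    · linarith [hgap k hk, mul_nonneg (sq_nonneg (-l a)) (hnn (k + 1))]
    · linarith [hgap k (by lia), mul_pos (pow_pos hb 2) (hpos (k + 1) (by lia))]

/-- Let `M` be a real symmetric `n × n` matrix with `Trace M ≥ 0`, whose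
eigenvalues (with multiplicity) consist of exactly one positive eigenvalue, exactly `r - 1`
negative eigenvalues and exactly `n - r` zero eigenvalues, where `2 ≤ r ≤ n`.  Write
`CharPoly_M(x) = det (x I - M) = Σ_{k=0}^n a_k x^k`.  If `Trace M = 0` then `a_k < 0` for
`n - r ≤ k ≤ n - 2`, and if `Trace M > 0` then `a_k < 0` for `n - r ≤ k ≤ n - 1`. -/
theorem coeff_charpoly_neg_of_one_pos_eigenvalue
    (n r : ℕ) (hr2 : 2 ≤ r) (hrn : r ≤ n)
    (M : Matrix (Fin n) (Fin n) ℝ) (hM : M.IsHermitian)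
    (htr : 0 ≤ M.trace)
    (hpos : (Finset.univ.filter fun i => 0 < hM.eigenvalues i).card = 1)
    (hneg : (Finset.univ.filter fun i => hM.eigenvalues i < 0).card = r - 1)
    (hzero : (Finset.univ.filter fun i => hM.eigenvalues i = 0).card = n - r) :
    (M.trace = 0 → ∀ k, n - r ≤ k → k ≤ n - 2 → M.charpoly.coeff k < 0) ∧
    (0 < M.trace → ∀ k, n - r ≤ k → k ≤ n - 1 → M.charpoly.coeff k < 0) := by
  obtain ⟨p, hp⟩ := Finset.card_eq_one.1 hpos
  set l := hM.eigenvalues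
  set N := Finset.univ.filter fun i => l i < 0
  have hp0 : 0 < l p := by
    have : p ∈ Finset.univ.filter fun i => 0 < l i := by simp [hp]
    simpa using this
  have hN : ∀ i ∈ N, l i < 0 := fun i hi => (Finset.mem_filter.1 hi).2
  have hnot : (Finset.univ.filter fun i => ¬ l i < 0) =
      (Finset.univ.filter fun i => 0 < l i) ∪ Finset.univ.filter fun i => l i = 0 := by
    ext i
    simp [le_iff_lt_or_eq, eq_comm]
  have hdisj : Disjoint (Finset.univ.filter fun i => 0 < l i)
      (Finset.univ.filter fun i => l i = 0) :=
    Finset.disjoint_filter.2 fun i _ h => h.ne'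
  have htrace : M.trace = ∑ i ∈ N, l i + l p := by
    have hz : ∑ i with l i = 0, l i = 0 :=
      Finset.sum_eq_zero fun i hi => (Finset.mem_filter.1 hi).2
    have h : M.trace = ∑ i, l i := by simpa using hM.trace_eq_sum_eigenvalues
    rw [h, ← Finset.sum_filter_add_sum_filter_not Finset.univ (fun i => l i < 0), hnot,
      Finset.sum_union hdisj, hp, hz, Finset.sum_singleton, add_zero]
  have hchar : M.charpoly = (∏ i ∈ N, (X - C (l i))) * (X - C (l p)) * X ^ (n - r) := by
    have hz : ∏ i with l i = 0, (X - C (l i)) = X ^ (n - r) := by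
      rw [← hzero]
      exact Finset.prod_eq_pow_card fun i hi => by simp [(Finset.mem_filter.1 hi).2]
    have h : M.charpoly = ∏ i, (X - C (l i)) := by simpa using hM.charpoly_eq
    rw [h, ← Finset.prod_filter_mul_prod_filter_not Finset.univ (fun i => l i < 0), hnot,
      Finset.prod_union hdisj, hp, hz, Finset.prod_singleton, mul_assoc]
  obtain ⟨-, hQpos, hQle, hQlt⟩ := coeff_prod_X_sub_C_of_neg l N hN
  set Q := ∏ i ∈ N, (X - C (l i))
  have hcoeff0 : M.charpoly.coeff (0 + (n - r)) < 0 := by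
    rw [hchar, coeff_mul_X_pow, mul_coeff_zero]
    simpa using mul_pos (hQpos 0 (by lia)) hp0
  have hcoeff (j : ℕ) : M.charpoly.coeff (j + 1 + (n - r)) =
      Q.coeff j - (-∑ i ∈ N, l i) * Q.coeff (j + 1) - M.trace * Q.coeff (j + 1) := by
    rw [hchar, coeff_mul_X_pow, mul_sub, coeff_sub, coeff_mul_X, coeff_mul_C, htrace]
    ring
  constructor
  · intro ht k hk hk'
    obtain ⟨j, rfl⟩ := Nat.exists_eq_add_of_le' hk
    cases j with
    | zero => exact hcoeff0
    | succ j =>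
      rw [hcoeff, ht]
      linarith [hQlt j (by lia)]
  · intro ht k hk hk'
    obtain ⟨j, rfl⟩ := Nat.exists_eq_add_of_le' hk
    cases j with
    | zero => exact hcoeff0
    | succ j =>
      rw [hcoeff]
      linarith [hQle j (by lia), mul_pos ht (hQpos (j + 1) (by lia))]
end

section
/- Let M be a real symmetric n×n matrix with exactly one positive eigenvalue, n−1 negative eigenvalues and no zero eigenvalue (inertia (1, n−1, 0)), and write CharPoly_M(x) = Σ_{k=0}^n a_k x^k. If Trace(M) = 0, then the sequence |a_0|, |a_1|, ..., |a_{n−2}| is log-concave and unimodal; if Trace(M) > 0, then the sequence |a_0|, |a_1|, ..., |a_{n−1}| is log-concave and unimodal. -/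
open Polynomial

/-- A finite real sequence `b 0, b 1, ..., b m` is unimodal if there is an index `k` such that
`b (j-1) ≤ b j` for all `j ≤ k` and `b j ≥ b (j+1)` for all `j ≥ k`. -/
def IsUnimodalSeq (b : ℕ → ℝ) (m : ℕ) : Prop :=
  ∃ k, k ≤ m ∧ (∀ j, 1 ≤ j → j ≤ k → b (j - 1) ≤ b j) ∧
    (∀ j, k ≤ j → j + 1 ≤ m → b (j + 1) ≤ b j)

/-- A finite real sequence `b 0, b 1, ..., b m` is log-concave if
`b i ^ 2 ≥ b (i-1) * b (i+1)` for all `1 ≤ i ≤ m - 1`. -/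
def IsLogConcaveSeq (b : ℕ → ℝ) (m : ℕ) : Prop :=
  ∀ i, 1 ≤ i → i + 1 ≤ m → b (i - 1) * b (i + 1) ≤ b i ^ 2

/-- The derivative of a real-rooted polynomial is real-rooted. -/
theorem Polynomial.Splits.derivative_real {p : ℝ[X]} (hp : p.Splits) : (derivative p).Splits := by
  rw [splits_iff_card_roots] at hp ⊢
  have hroots := card_roots_le_derivative p
  have hle := card_roots' (derivative p)
  have hdeg := natDegree_derivative_le p
  omega

/-- Iterated derivatives of a real-rooted polynomial are real-rooted. -/
theorem Polynomial.Splits.iterate_derivative_real {p : ℝ[X]} (hp : p.Splits) (k : ℕ) :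
    (derivative^[k] p).Splits := by
  induction k with
  | zero => exact hp
  | succ k ih =>
    rw [Function.iterate_succ_apply']
    exact ih.derivative_real

/-- The Laguerre inequality `p * p'' ≤ p' ^ 2` for real-rooted polynomials. -/
theorem Polynomial.Splits.laguerre_inequality {p : ℝ[X]} (hp : p.Splits) (x : ℝ) :
    p.eval x * (derivative (derivative p)).eval x ≤ (derivative p).eval x ^ 2 := by
  have key : ∀ s : Multiset ℝ,
      ((s.map fun a => X - C a).prod).eval x *
        (derivative (derivative (s.map fun a => X - C a).prod)).eval x ≤
        (derivative (s.map fun a => X - C a).prod).eval x ^ 2 := by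
    intro s
    induction s using Multiset.induction with
    | empty => simp
    | cons r s ih =>
      simp only [Multiset.map_cons, Multiset.prod_cons]
      generalize (s.map fun a => X - C a).prod = q at ih ⊢
      simp only [derivative_mul, derivative_X_sub_C, one_mul, derivative_add, eval_add, eval_mul,
        eval_sub, eval_X, eval_C]
      nlinarith [sq_nonneg (q.eval x), mul_le_mul_of_nonneg_left ih (sq_nonneg (x - r))]
  rw [hp.eq_prod_roots]
  simp only [derivative_C_mul, eval_mul, eval_C]
  nlinarith [mul_le_mul_of_nonneg_left (key p.roots) (sq_nonneg p.leadingCoeff)]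

/-- A form of Newton's inequality for the coefficients of a real-rooted polynomial. -/
theorem Polynomial.Splits.newton_inequality {p : ℝ[X]} (hp : p.Splits) (k : ℕ) :
    (k + 2 : ℝ) * (p.coeff k * p.coeff (k + 2)) ≤ (k + 1) * p.coeff (k + 1) ^ 2 := by
  have h := (hp.iterate_derivative_real k).laguerre_inequality 0
  simp only [← Function.iterate_succ_apply' derivative, ← coeff_zero_eq_eval_zero,
    coeff_iterate_derivative, zero_add, Nat.descFactorial_self, nsmul_eq_mul,
    Nat.factorial_succ] at h
  push_cast at h
  have hf : (0 : ℝ) < (k.factorial : ℝ) ^ 2 * (k + 1) := by positivity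
  refine le_of_mul_le_mul_left ?_ hf
  linear_combination h

/-- The coefficients of a real-rooted polynomial satisfy `a_k a_{k+2} ≤ a_{k+1} ^ 2`. -/
theorem Polynomial.Splits.coeff_mul_coeff_le_sq {p : ℝ[X]} (hp : p.Splits) (k : ℕ) :
    p.coeff k * p.coeff (k + 2) ≤ p.coeff (k + 1) ^ 2 := by
  have h := hp.newton_inequality k
  have hk : (0 : ℝ) ≤ k := k.cast_nonneg
  nlinarith [sq_nonneg (p.coeff (k + 1)), mul_nonneg hk (sq_nonneg (p.coeff (k + 1)))]

/-- If two coefficients of a real-rooted polynomial at distance two have the same strict sign, then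
the log-concavity inequality between them is strict. -/
theorem Polynomial.Splits.coeff_mul_coeff_lt_sq {p : ℝ[X]} (hp : p.Splits) (k : ℕ)
    (hpos : 0 < p.coeff k * p.coeff (k + 2)) :
    p.coeff k * p.coeff (k + 2) < p.coeff (k + 1) ^ 2 := by
  have h := hp.newton_inequality k
  have hk : (0 : ℝ) < k + 1 := by positivity
  refine lt_of_mul_lt_mul_left ?_ hk.le
  linarith

/-- A monic polynomial with only negative roots has positive coefficients. -/
theorem coeff_prod_X_sub_C_pos {ι : Type*} (s : Finset ι) (f : ι → ℝ) (hf : ∀ i ∈ s, f i < 0)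
    {k : ℕ} (hk : k ≤ s.card) : 0 < (∏ i ∈ s, (X - C (f i))).coeff k := by
  classical
  induction s using Finset.induction generalizing k with
  | empty => simp_all
  | insert i s hi ih =>
    rw [Finset.prod_insert hi]
    rw [Finset.card_insert_of_notMem hi] at hk
    have hfi := hf i (Finset.mem_insert_self i s)
    have ih' := fun {k : ℕ} => @ih (fun j hj => hf j (Finset.mem_insert_of_mem hj)) k
    rcases k with _ | k
    · rw [mul_coeff_zero]
      have := @ih' 0 (Nat.zero_le _)
      simp only [coeff_sub, coeff_X_zero, coeff_C_zero, zero_sub]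
      exact mul_pos (by linarith) this
    · rw [coeff_X_sub_C_mul]
      have h1 := @ih' k (by omega)
      rcases hk.eq_or_lt with h | h
      · have hdeg : (∏ i ∈ s, (X - C (f i))).coeff (k + 1) = 0 := by
          apply coeff_eq_zero_of_natDegree_lt
          rw [natDegree_prod_of_monic _ _ fun j _ => monic_X_sub_C (f j)]
          simp only [natDegree_X_sub_C, Finset.sum_const, smul_eq_mul, mul_one]
          omega
        rw [hdeg]
        linarith
      · have h2 := @ih' (k + 1) (by omega)
        nlinarith

/-- Let `q` be real-rooted of degree `m` with positive coefficients and `0 < c`.  If the coefficient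
of `(X - c) q` at `m` is nonpositive, then all coefficients below `m` are negative. -/
theorem coeff_X_sub_C_mul_neg {q : ℝ[X]} (hq : q.Splits) {m : ℕ}
    (hpos : ∀ k ≤ m, 0 < q.coeff k) {c : ℝ} (hc : 0 < c)
    (htop : ((X - C c) * q).coeff m ≤ 0) {k : ℕ} (hk : k < m) :
    ((X - C c) * q).coeff k < 0 := by
  have step : ∀ j, j + 2 ≤ m → ((X - C c) * q).coeff (j + 2) ≤ 0 →
      ((X - C c) * q).coeff (j + 1) < 0 := by
    intro j hj h
    rw [coeff_X_sub_C_mul] at h ⊢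
    have h0 := hpos j (by omega)
    have h1 := hpos (j + 1) (by omega)
    have h2 := hpos (j + 2) hj
    have hlt := hq.coeff_mul_coeff_lt_sq j (mul_pos h0 h2)
    by_contra! hge
    nlinarith
  rcases k with _ | k
  · have h0 := hpos 0 (Nat.zero_le _)
    simp only [mul_coeff_zero, coeff_sub, coeff_X_zero, coeff_C_zero, zero_sub]
    nlinarith
  · refine step k hk ?_
    refine Nat.decreasingInduction' (P := fun j => 1 < j → ((X - C c) * q).coeff j ≤ 0)
      (n := m) ?_ hk (fun _ => htop) (by omega)
    intro j _ hkj ih hj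
    obtain ⟨i, rfl⟩ : ∃ i, j = i + 1 := ⟨j - 1, by omega⟩
    exact (step i (by omega) (ih (by omega))).le

/-- A positive log-concave sequence is unimodal. -/
theorem IsLogConcaveSeq.isUnimodalSeq {b : ℕ → ℝ} {m : ℕ} (hb : IsLogConcaveSeq b m)
    (hpos : ∀ k ≤ m, 0 < b k) : IsUnimodalSeq b m := by
  classical
  have hex : ∃ k, m ≤ k ∨ b (k + 1) ≤ b k := ⟨m, Or.inl le_rfl⟩
  refine ⟨Nat.find hex, Nat.find_min' hex (Or.inl le_rfl), ?_, ?_⟩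
  · intro j hj hjk
    have h := Nat.find_min hex (m := j - 1) (by omega)
    rw [not_or, Nat.sub_add_cancel hj] at h
    exact (not_le.mp h.2).le
  · intro j hj
    induction j, hj using Nat.le_induction with
    | base =>
      intro hm
      exact (Nat.find_spec hex).resolve_left (by omega)
    | succ j _ ih =>
      intro hm
      have hle := ih (by omega)
      have hlc : b j * b (j + 1 + 1) ≤ b (j + 1) ^ 2 := hb (j + 1) (by omega) hm
      have hj0 := hpos j (by omega)
      have hj1 := hpos (j + 1) (by omega)
      nlinarith

/-- The absolute values of the coefficients of a real-rooted polynomial form a log-concave unimodal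
sequence as long as these coefficients are negative. -/
theorem Polynomial.Splits.abs_coeff_logConcave_unimodal {p : ℝ[X]} (hp : p.Splits) {m : ℕ}
    (hneg : ∀ k ≤ m, p.coeff k < 0) :
    IsLogConcaveSeq (fun k => |p.coeff k|) m ∧ IsUnimodalSeq (fun k => |p.coeff k|) m := by
  have hlc : IsLogConcaveSeq (fun k => |p.coeff k|) m := by
    intro i hi him
    obtain ⟨i, rfl⟩ : ∃ j, i = j + 1 := ⟨i - 1, by omega⟩
    simp only [Nat.add_sub_cancel, sq_abs]
    rw [← abs_mul, abs_of_pos (mul_pos_of_neg_of_neg (hneg i (by omega)) (hneg (i + 1 + 1) him))]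
    exact hp.coeff_mul_coeff_le_sq i
  exact ⟨hlc, hlc.isUnimodalSeq fun k hk => abs_pos.mpr (hneg k hk).ne⟩

/-- If a Hermitian real matrix has exactly one positive eigenvalue, all others negative, and
nonnegative trace, then the coefficients of its characteristic polynomial below degree `n - 1`
are negative. -/
theorem Matrix.IsHermitian.coeff_charpoly_neg {n : ℕ} {M : Matrix (Fin n) (Fin n) ℝ}
    (hM : M.IsHermitian) (hpos : (Finset.univ.filter fun i => 0 < hM.eigenvalues i).card = 1)
    (hzero : (Finset.univ.filter fun i => hM.eigenvalues i = 0).card = 0)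
    (htr : 0 ≤ M.trace) {k : ℕ} (hk : k < n - 1) : M.charpoly.coeff k < 0 := by
  obtain ⟨i₀, hi₀⟩ := Finset.card_eq_one.mp hpos
  have hi₀pos : 0 < hM.eigenvalues i₀ := by
    have : i₀ ∈ Finset.univ.filter fun i => 0 < hM.eigenvalues i := by simp [hi₀]
    simpa using this
  have hrest : ∀ i ∈ Finset.univ.erase i₀, hM.eigenvalues i < 0 := by
    intro i hi
    have hne : hM.eigenvalues i ≠ 0 := by
      rw [Finset.card_eq_zero, Finset.filter_eq_empty_iff] at hzero
      exact hzero (Finset.mem_univ i)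
    have hnpos : ¬ 0 < hM.eigenvalues i := by
      intro h
      have : i ∈ Finset.univ.filter fun i => 0 < hM.eigenvalues i := by simpa using h
      rw [hi₀, Finset.mem_singleton] at this
      exact Finset.ne_of_mem_erase hi this
    exact lt_of_le_of_ne (not_lt.mp hnpos) hne
  have hcp : M.charpoly = (X - C (hM.eigenvalues i₀)) *
      ∏ i ∈ Finset.univ.erase i₀, (X - C (hM.eigenvalues i)) := by
    rw [hM.charpoly_eq]
    exact (Finset.mul_prod_erase _ (fun i => X - C (hM.eigenvalues i)) (Finset.mem_univ i₀)).symm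
  have hcard : (Finset.univ.erase i₀).card = n - 1 := by simp
  have htop : M.charpoly.coeff (n - 1) ≤ 0 := by
    have : Nonempty (Fin n) := ⟨i₀⟩
    have h := M.trace_eq_neg_charpoly_coeff
    rw [Fintype.card_fin] at h
    linarith
  rw [hcp] at htop ⊢
  exact coeff_X_sub_C_mul_neg (Splits.prod fun i _ => Splits.X_sub_C _)
    (fun j hj => coeff_prod_X_sub_C_pos _ _ hrest (hcard ▸ hj)) hi₀pos htop hk

/-- Let `M` be a real symmetric `n × n` matrix with inertia `(1, n-1, 0)` and
write `CharPoly_M(x) = det (x I - M) = Σ_{k=0}^n a_k x^k`.  If `Trace M = 0` then the sequence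
`|a_0|, ..., |a_{n-2}|` is log-concave and unimodal, and if `Trace M > 0` then the sequence
`|a_0|, ..., |a_{n-1}|` is log-concave and unimodal. -/
theorem abs_coeff_charpoly_logConcave_unimodal
    (n : ℕ)
    (M : Matrix (Fin n) (Fin n) ℝ) (hM : M.IsHermitian)
    (hpos : (Finset.univ.filter fun i => 0 < hM.eigenvalues i).card = 1)
    (hneg : (Finset.univ.filter fun i => hM.eigenvalues i < 0).card = n - 1)
    (hzero : (Finset.univ.filter fun i => hM.eigenvalues i = 0).card = 0) :
    (M.trace = 0 →
      IsLogConcaveSeq (fun k => |M.charpoly.coeff k|) (n - 2) ∧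
      IsUnimodalSeq (fun k => |M.charpoly.coeff k|) (n - 2)) ∧
    (0 < M.trace →
      IsLogConcaveSeq (fun k => |M.charpoly.coeff k|) (n - 1) ∧
      IsUnimodalSeq (fun k => |M.charpoly.coeff k|) (n - 1)) := by
  have hcoeff : 0 ≤ M.trace → ∀ k < n - 1, M.charpoly.coeff k < 0 :=
    fun htr k hk => hM.coeff_charpoly_neg hpos hzero htr hk
  have hn : 0 < n := by
    obtain ⟨i, -⟩ := Finset.card_pos.mp (hpos.symm ▸ Nat.one_pos)
    exact i.pos
  have htrace : M.trace = -M.charpoly.coeff (n - 1) := by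
    have : Nonempty (Fin n) := ⟨⟨0, hn⟩⟩
    simpa using M.trace_eq_neg_charpoly_coeff
  constructor
  · intro htr
    rcases Nat.lt_or_ge n 2 with h | h
    · rw [Nat.sub_eq_zero_of_le h.le]
      exact ⟨fun i _ hi => by omega, 0, le_rfl, fun j _ _ => by omega, fun j _ _ => by omega⟩
    · exact hM.splits_charpoly.abs_coeff_logConcave_unimodal
        fun k hk => hcoeff htr.ge k (by omega)
  · intro htr
    refine hM.splits_charpoly.abs_coeff_logConcave_unimodal fun k hk => ?_
    rcases hk.eq_or_lt with rfl | hlt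
    · linarith
    · exact hcoeff htr.le k hlt
end

section
/- Let T be a tree on n ≥ 3 vertices, E its edge set, and f = {i,j} a non-edge of T. Then the n×n matrix N = Min4PC_T[B,B], where B = E ∪ {f}, has exactly n−1 negative eigenvalues and exactly one positive eigenvalue (counted with multiplicity). -/
/-- The Min4PC value of two 2-element subsets of vertices (represented as elements of `Sym2`),
with respect to a distance function `d`:
`Min4PC({i,j},{k,l}) = min { d(i,j)+d(k,l), d(i,k)+d(j,l), d(i,l)+d(j,k) }`. -/
noncomputable def min4PC {V : Type*} (d : V → V → ℕ) (e e' : Sym2 V) : ℕ :=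
  min (d e.out.1 e.out.2 + d e'.out.1 e'.out.2)
    (min (d e.out.1 e'.out.1 + d e.out.2 e'.out.2)
      (d e.out.1 e'.out.2 + d e.out.2 e'.out.1))

open Finset Matrix

/-- The quadratic form of a real symmetric matrix is diagonal in the eigenvector coordinates. -/
lemma Matrix.IsHermitian.dotProduct_mulVec_eigenvectorUnitary {ι : Type*} [Fintype ι]
    [DecidableEq ι] {N : Matrix ι ι ℝ} (hN : N.IsHermitian) (c : ι → ℝ) :
    ((hN.eigenvectorUnitary : Matrix ι ι ℝ) *ᵥ c) ⬝ᵥ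
        (N *ᵥ ((hN.eigenvectorUnitary : Matrix ι ι ℝ) *ᵥ c)) =
      ∑ i, hN.eigenvalues i * c i ^ 2 := by
  set U : Matrix ι ι ℝ := hN.eigenvectorUnitary.val with hU
  have hUU : star U * U = 1 := Unitary.coe_star_mul_self hN.eigenvectorUnitary
  have hspec : N = U * diagonal hN.eigenvalues * star U := by
    conv_lhs => rw [hN.spectral_theorem, Unitary.conjStarAlgAut_apply]
    rfl
  have hNU : N * U = U * diagonal hN.eigenvalues := by
    conv_lhs => rw [hspec]
    rw [Matrix.mul_assoc, hUU, Matrix.mul_one]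
  have hT : Uᵀ * U = 1 := by
    rw [← hUU, star_eq_conjTranspose, conjTranspose_eq_transpose_of_trivial]
  rw [mulVec_mulVec, hNU, ← mulVec_mulVec, dotProduct_mulVec, ← mulVec_transpose, mulVec_mulVec,
    hT, one_mulVec]
  simp only [dotProduct, mulVec_diagonal]
  exact sum_congr rfl fun i _ => by ring

/-- A real symmetric matrix whose quadratic form takes a positive value and is negative definite
on a hyperplane has exactly one positive eigenvalue, and its other eigenvalues are negative. -/
lemma Matrix.IsHermitian.exists_eigenvalues_pos_and_neg {ι : Type*} [Fintype ι]
    [DecidableEq ι] {N : Matrix ι ι ℝ} (hN : N.IsHermitian) {w : ι → ℝ}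
    (hw : 0 < w ⬝ᵥ (N *ᵥ w)) {y : ι → ℝ}
    (hy : ∀ x, x ≠ 0 → y ⬝ᵥ x = 0 → x ⬝ᵥ (N *ᵥ x) < 0) :
    ∃ i, 0 < hN.eigenvalues i ∧ ∀ j, j ≠ i → hN.eigenvalues j < 0 := by
  set U : Matrix ι ι ℝ := hN.eigenvectorUnitary.val with hU
  have hUU : star U * U = 1 := Unitary.coe_star_mul_self hN.eigenvectorUnitary
  have hUU' : U * star U = 1 := Unitary.coe_mul_star_self hN.eigenvectorUnitary
  obtain ⟨i, hi⟩ : ∃ i, 0 < hN.eigenvalues i := by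
    by_contra! h
    have hwU : U *ᵥ (star U *ᵥ w) = w := by rw [mulVec_mulVec, hUU', one_mulVec]
    have := hN.dotProduct_mulVec_eigenvectorUnitary (star U *ᵥ w)
    rw [← hU, hwU] at this
    rw [this] at hw
    exact absurd hw (not_lt.2 (sum_nonpos fun i _ =>
      mul_nonpos_of_nonpos_of_nonneg (h i) (sq_nonneg _)))
  refine ⟨i, hi, fun j hji => ?_⟩
  by_contra! hj
  obtain ⟨c, hc0, hcy, hcij⟩ : ∃ c : ι → ℝ, c ≠ 0 ∧ y ⬝ᵥ (U *ᵥ c) = 0 ∧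
      ∀ k, k ≠ i → k ≠ j → c k = 0 := by
    set z : ι → ℝ := y ᵥ* U
    by_cases hz : z j = 0
    · refine ⟨Pi.single j 1, by simp, ?_, fun k _ hk => by simp [hk]⟩
      rw [dotProduct_mulVec]
      simpa using hz
    · refine ⟨Pi.single i (z j) - Pi.single j (z i), fun h => hz ?_, ?_,
        fun k hk hk' => by simp [hk, hk']⟩
      · simpa [Pi.single_apply, hji.symm] using congrFun h i
      · rw [dotProduct_mulVec, dotProduct_sub, dotProduct_single, dotProduct_single]
        ring
  have hUc : U *ᵥ c ≠ 0 := fun h => hc0 <| by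
    rw [← one_mulVec c, ← hUU, ← mulVec_mulVec, h, mulVec_zero]
  have hneg := hy _ hUc hcy
  rw [hU, hN.dotProduct_mulVec_eigenvectorUnitary] at hneg
  refine absurd hneg (not_lt.2 (sum_nonneg fun k _ => ?_))
  by_cases hki : k = i
  · subst hki; positivity
  by_cases hkj : k = j
  · subst hkj; positivity
  simp [hcij k hki hkj]

namespace SimpleGraph

variable {V : Type*} {G : SimpleGraph V}

/-- An edge of a walk splits it into a walk before the edge and a walk after the edge. -/
lemma Walk.dist_add_dist_lt_of_mem_edges {u v a b : V} (p : G.Walk u v) (hG : G.Connected)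
    (h : s(a, b) ∈ p.edges) :
    G.dist u a + G.dist b v < p.length ∨ G.dist u b + G.dist a v < p.length := by
  induction p with
  | nil => simp at h
  | @cons u w v huw q ih =>
    rw [Walk.edges_cons, List.mem_cons] at h
    have hq := G.dist_le q
    rw [Walk.length_cons]
    rcases h with h | h
    · rcases Sym2.eq_iff.1 h with ⟨rfl, rfl⟩ | ⟨rfl, rfl⟩
      · left; simp; omega
      · right; simp; omega
    · have h1 := hG.dist_triangle (u := u) (v := w) (w := a)
      have h2 := hG.dist_triangle (u := u) (v := w) (w := b)
      have h3 := dist_eq_one_iff_adj.2 huw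
      have := ih h
      omega

/-- In a tree, an edge `ab` such that `a` is the endpoint closer to `u` and `b` is the endpoint
closer to `v` lies on each path from `u` to `v`. -/
lemma IsTree.mem_edges_of_dist (hG : G.IsTree) {u v a b : V} {p : G.Walk u v} (hp : p.IsPath)
    (hab : G.Adj a b) (hu : G.dist u b = G.dist u a + 1) (hv : G.dist v a = G.dist v b + 1) :
    s(a, b) ∈ p.edges := by
  classical
  obtain ⟨q, hq, hql⟩ := hG.connected.exists_path_of_dist u a
  obtain ⟨r, hr, hrl⟩ := hG.connected.exists_path_of_dist b v
  have hdisj : q.support.Disjoint r.support := by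
    intro z hzq hzr
    have h1 := G.dist_le (q.takeUntil z hzq)
    have h2 := G.dist_le (q.dropUntil z hzq)
    have h3 := G.dist_le (r.takeUntil z hzr)
    have h4 := G.dist_le (r.dropUntil z hzr)
    have h5 := congrArg Walk.length (q.take_spec hzq)
    have h6 := congrArg Walk.length (r.take_spec hzr)
    rw [Walk.length_append] at h5 h6
    have h7 := hG.connected.dist_triangle (u := u) (v := z) (w := b)
    have h8 := hG.connected.dist_triangle (u := v) (v := z) (w := a)
    rw [G.dist_comm (u := z) (v := b)] at h7
    rw [G.dist_comm (u := v) (v := z)] at h8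
    rw [G.dist_comm (u := v) (v := b)] at hv
    omega
  have hpath : (q.append (Walk.cons hab r)).IsPath := by
    rw [Walk.isPath_def, Walk.support_append, Walk.support_cons, List.tail_cons]
    exact hq.support_nodup.append hr.support_nodup hdisj
  have : p = q.append (Walk.cons hab r) :=
    have := hG.isAcyclic.subsingleton_path u v
    congrArg Subtype.val (Subsingleton.elim (⟨p, hp⟩ : G.Path u v) ⟨_, hpath⟩)
  simp [this]

/-- In a tree, distinct edges `ab` and `cd` satisfy `d(a,c) + d(b,d) ≥ 2`. -/
lemma IsTree.two_le_dist_add_dist (hG : G.IsTree) {a b c d : V} (hab : G.Adj a b)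
    (hcd : G.Adj c d) (hne : s(a, b) ≠ s(c, d)) : 2 ≤ G.dist a c + G.dist b d := by
  have key : ∀ {a b d : V}, G.Adj a b → G.Adj a d → b ≠ d → 2 ≤ G.dist b d := by
    intro a b d hab had hbd
    have h1 := hG.connected.pos_dist_of_ne hbd
    have h2 := hG.dist_ne_of_adj b had
    rw [dist_eq_one_iff_adj.2 hab.symm] at h2
    omega
  by_cases hac : a = c
  · subst hac
    have := key hab hcd (by rintro rfl; exact hne rfl)
    omega
  by_cases hbd : b = d
  · subst hbd
    have := key hab.symm hcd.symm hac
    omega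
  have := hG.connected.pos_dist_of_ne hac
  have := hG.connected.pos_dist_of_ne hbd
  omega

end SimpleGraph

section Min4PC

variable {V : Type*} {T : SimpleGraph V}

lemma Sym2.mk_out_eq (e : Sym2 V) : s(e.out.1, e.out.2) = e := Quot.out_eq e

lemma min4PC_self (d : V → V → ℕ) (hd : ∀ v, d v v = 0) (e : Sym2 V) : min4PC d e e = 0 := by
  simp [min4PC, hd]

lemma min4PC_dist_comm (e f : Sym2 V) : min4PC T.dist e f = min4PC T.dist f e := by
  simp only [min4PC, T.dist_comm (u := e.out.1) (v := f.out.1),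
    T.dist_comm (u := e.out.2) (v := f.out.2), T.dist_comm (u := e.out.1) (v := f.out.2),
    T.dist_comm (u := e.out.2) (v := f.out.1)]
  omega

lemma min4PC_dist_of_mem_edgeSet (hT : T.IsTree) {e e' : Sym2 V} (he : e ∈ T.edgeSet)
    (he' : e' ∈ T.edgeSet) (hne : e ≠ e') : min4PC T.dist e e' = 2 := by
  rw [min4PC]
  rw [← e.mk_out_eq] at he hne
  rw [← e'.mk_out_eq] at he' hne
  have h1 := hT.two_le_dist_add_dist he he' hne
  have h2 := hT.two_le_dist_add_dist he he'.symm (by rwa [Sym2.eq_swap (a := e'.out.2)])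
  have h3 := SimpleGraph.dist_eq_one_iff_adj.2 he
  have h4 := SimpleGraph.dist_eq_one_iff_adj.2 he'
  rw [h3, h4, min_eq_left (le_min h1 h2)]

/-- The Min4PC value of an edge `e` and a pair `f` depends only on whether `e` lies on the path
joining the two vertices of `f`. -/
lemma min4PC_dist_edge [DecidableEq V] (hT : T.IsTree) {e f : Sym2 V} (he : e ∈ T.edgeSet)
    {p : T.Walk f.out.1 f.out.2} (hp : p.IsPath) (hpl : p.length = T.dist f.out.1 f.out.2) :
    (min4PC T.dist e f : ℝ) =
      T.dist f.out.1 f.out.2 + 1 - 2 * (if e ∈ p.edges then 1 else 0) := by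
  rw [min4PC]
  have hab : T.Adj e.out.1 e.out.2 := by rwa [← SimpleGraph.mem_edgeSet, e.mk_out_eq]
  have hiff : e ∈ p.edges ↔ s(e.out.1, e.out.2) ∈ p.edges := by rw [e.mk_out_eq]
  simp only [hiff]
  clear hiff
  generalize e.out.1 = a at *
  generalize e.out.2 = b at *
  generalize f.out.1 = i at *
  generalize f.out.2 = j at *
  have h1 := SimpleGraph.dist_eq_one_iff_adj.2 hab
  have ha := hT.connected.dist_triangle (u := i) (v := a) (w := j)
  have hb := hT.connected.dist_triangle (u := i) (v := b) (w := j)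
  have hi := hT.dist_eq_dist_add_one_of_adj i hab
  have hj := hT.dist_eq_dist_add_one_of_adj j hab
  rw [T.dist_comm (u := a) (v := i), T.dist_comm (u := b) (v := j),
    T.dist_comm (u := a) (v := j), T.dist_comm (u := b) (v := i)]
  rw [T.dist_comm (u := a) (v := j)] at ha
  rw [T.dist_comm (u := b) (v := j)] at hb
  split_ifs with hmem
  · have h := p.dist_add_dist_lt_of_mem_edges hT.connected hmem
    rw [T.dist_comm (u := a) (v := j), T.dist_comm (u := b) (v := j)] at h
    have : min (T.dist a b + T.dist i j)
        (min (T.dist i a + T.dist j b) (T.dist j a + T.dist i b)) + 1 = T.dist i j := by omega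
    rw [eq_sub_iff_add_eq, mul_one, ← one_add_one_eq_two, ← add_assoc]
    exact congrArg (· + 1) (by exact_mod_cast this)
  · have hn1 : ¬(T.dist i b = T.dist i a + 1 ∧ T.dist j a = T.dist j b + 1) := fun h =>
      hmem (hT.mem_edges_of_dist hp hab h.1 h.2)
    have hn2 : ¬(T.dist i a = T.dist i b + 1 ∧ T.dist j b = T.dist j a + 1) := fun h =>
      hmem (Sym2.eq_swap (a := a) ▸ hT.mem_edges_of_dist hp hab.symm h.1 h.2)
    rw [min_eq_left (le_min (by omega) (by omega)), h1]
    push_cast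
    ring

end Min4PC

/-- The quadratic form of the matrix obtained by bordering `2 (J - I)` with `v` and a zero corner,
the border being indexed by `k₀`. -/
lemma dotProduct_mulVec_bordered {ι : Type*} [Fintype ι] [DecidableEq ι] {N : Matrix ι ι ℝ}
    {k₀ : ι} {v : ι → ℝ} (hdiag : ∀ k, N k k = 0) (hcol : ∀ k, k ≠ k₀ → N k k₀ = v k)
    (hrow : ∀ k, k ≠ k₀ → N k₀ k = v k)
    (hoff : ∀ k l, k ≠ k₀ → l ≠ k₀ → k ≠ l → N k l = 2) (x : ι → ℝ) :
    x ⬝ᵥ (N *ᵥ x) = 2 * ((∑ k ∈ univ.erase k₀, x k) ^ 2 - ∑ k ∈ univ.erase k₀, x k ^ 2) +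
      2 * x k₀ * ∑ k ∈ univ.erase k₀, v k * x k := by
  have hrow₀ : (N *ᵥ x) k₀ = ∑ k ∈ univ.erase k₀, v k * x k := by
    rw [mulVec, dotProduct, ← add_sum_erase _ _ (mem_univ k₀), hdiag, zero_mul, zero_add]
    exact sum_congr rfl fun k hk => by rw [hrow k (ne_of_mem_erase hk)]
  have hrowk : ∀ k ∈ univ.erase k₀,
      (N *ᵥ x) k = v k * x k₀ + 2 * (∑ l ∈ univ.erase k₀, x l) - 2 * x k := by
    intro k hk
    have hk' := ne_of_mem_erase hk
    rw [mulVec, dotProduct, ← add_sum_erase _ _ (mem_univ k₀), hcol k hk',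
      ← add_sum_erase _ _ hk, ← add_sum_erase _ _ hk, hdiag,
      sum_congr rfl (g := fun l => 2 * x l) fun l hl => ?_, ← mul_sum]
    · ring
    · rw [hoff k l hk' (ne_of_mem_erase (mem_of_mem_erase hl)) (ne_of_mem_erase hl).symm]
  have hsum : ∑ k ∈ univ.erase k₀, x k * (N *ᵥ x) k = ∑ k ∈ univ.erase k₀,
      (x k₀ * (v k * x k) + 2 * (∑ l ∈ univ.erase k₀, x l) * x k - 2 * x k ^ 2) :=
    sum_congr rfl fun k hk => by rw [hrowk k hk]; ring
  rw [dotProduct, ← add_sum_erase _ _ (mem_univ k₀), hrow₀, hsum, sum_sub_distrib, sum_add_distrib, ← mul_sum, ← mul_sum, ← mul_sum]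
  ring

/-- Negativity of the form `2 (S² - ∑ x²) + 2 t ∑ v x` on a hyperplane, when the entries of `v`
take the value `d - 1` exactly `d` times and the value `d + 1` otherwise. -/
lemma bordered_form_neg {ι : Type*} {s P : Finset ι} [DecidableEq ι] (hP : P ⊆ s) (hP2 : 2 ≤ #P)
    {v : ι → ℝ} (hv : ∀ k ∈ s, v k = #P + 1 - 2 * (if k ∈ P then 1 else 0))
    {x : ι → ℝ} {t : ℝ} (hx : t ≠ 0 ∨ ∃ k ∈ s, x k ≠ 0)
    (hxt : 2 * ((#s : ℝ) - 1) * ∑ k ∈ s, x k + (∑ k ∈ s, v k) * t = 0) :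
    2 * ((∑ k ∈ s, x k) ^ 2 - ∑ k ∈ s, x k ^ 2) + 2 * t * ∑ k ∈ s, v k * x k < 0 := by
  have hm : (2 : ℝ) ≤ #s := by exact_mod_cast hP2.trans (card_le_card hP)
  have hd : (2 : ℝ) ≤ #P := by exact_mod_cast hP2
  have hind : ∑ k ∈ s, (if k ∈ P then (1 : ℝ) else 0) = #P := by
    rw [sum_ite_mem, inter_eq_right.2 hP]; simp
  have hV : ∑ k ∈ s, v k = #s * (#P + 1) - 2 * #P := by
    rw [sum_congr rfl hv, sum_sub_distrib, ← mul_sum, hind]; simp; ring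
  have hW : ∑ k ∈ s, v k ^ 2 = #s * ((#P : ℝ) + 1) ^ 2 - 4 * (#P : ℝ) ^ 2 := by
    rw [sum_congr rfl (g := fun k => ((#P : ℝ) + 1) ^ 2 - 4 * #P * (if k ∈ P then 1 else 0))
      fun k hk => by rw [hv k hk]; split_ifs <;> ring, sum_sub_distrib, ← mul_sum, hind]
    simp
    ring
  have hcs := sq_sum_le_card_mul_sum_sq (s := s) (f := fun k => x k - t / 2 * v k)
  have hu : ∑ k ∈ s, (x k - t / 2 * v k) = ∑ k ∈ s, x k - t / 2 * ∑ k ∈ s, v k := by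
    rw [sum_sub_distrib, mul_sum]
  have hu2 : ∑ k ∈ s, (x k - t / 2 * v k) ^ 2 =
      ∑ k ∈ s, x k ^ 2 - t * ∑ k ∈ s, v k * x k + t ^ 2 / 4 * ∑ k ∈ s, v k ^ 2 := by
    rw [mul_sum, mul_sum, ← sum_sub_distrib, ← sum_add_distrib]
    exact sum_congr rfl fun k _ => by ring
  rw [hu, hu2, hW] at hcs
  rw [hV] at hcs hxt
  by_cases ht : t = 0
  · subst ht
    obtain ⟨k, hk, hxk⟩ := hx.resolve_left (by simp)
    have hS : ∑ k ∈ s, x k = 0 := by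
      have : 2 * ((#s : ℝ) - 1) ≠ 0 := by nlinarith
      simpa [this] using hxt
    have hX : 0 < ∑ k ∈ s, x k ^ 2 :=
      sum_pos' (fun k _ => sq_nonneg _) ⟨k, hk, by positivity⟩
    rw [hS]
    linarith
  · generalize ∑ k ∈ s, x k = S at *
    generalize ∑ k ∈ s, x k ^ 2 = X at *
    generalize ∑ k ∈ s, v k * x k = Y at *
    generalize (#s : ℝ) = m at *
    generalize (#P : ℝ) = d at *
    have hVt : (m * (d + 1) - 2 * d) * t = -(2 * (m - 1) * S) := by linarith
    have hlin : S - t / 2 * (m * (d + 1) - 2 * d) = m * S := by linarith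
    rw [hlin] at hcs
    have hcs' : m * S ^ 2 ≤ X - t * Y + t ^ 2 / 4 * (m * (d + 1) ^ 2 - 4 * d ^ 2) := by
      refine le_of_mul_le_mul_left ?_ (show 0 < m by linarith)
      linarith
    have hsq : 4 * (m - 1) ^ 2 * S ^ 2 = (m * (d + 1) - 2 * d) ^ 2 * t ^ 2 := by
      rw [← mul_pow, hVt]; ring
    have hpos : 0 < m * (d - 1) ^ 2 * t ^ 2 := by
      have : 0 < d - 1 := by linarith
      have : 0 < m := by linarith
      positivity
    refine neg_of_mul_neg_right (a := m - 1) ?_ (by linarith)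
    have := mul_le_mul_of_nonneg_left hcs' (show 0 ≤ m - 1 by linarith)
    linarith

/-- Let `T` be a tree on `n ≥ 3` vertices, `E` its edge set and `f` a non-edge
of `T`.  Then the `n × n` matrix `N = Min4PC_T[B,B]`, where `B = E ∪ {f}` (enumerated by an
injection `b : Fin n → Sym2 (Fin n)` with range `E ∪ {f}`), has exactly `n - 1` negative
eigenvalues and exactly one positive eigenvalue, counted with multiplicity. -/
theorem inertia_min4PC_basis
    (n : ℕ) (hn : 3 ≤ n) (T : SimpleGraph (Fin n)) (hT : T.IsTree)
    (f : Sym2 (Fin n)) (hf_diag : ¬ f.IsDiag) (hf_nonedge : f ∉ T.edgeSet)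
    (b : Fin n → Sym2 (Fin n)) (hb_inj : Function.Injective b)
    (hb_range : Set.range b = T.edgeSet ∪ {f})
    (N : Matrix (Fin n) (Fin n) ℝ)
    (hN : N = Matrix.of fun i j => (min4PC T.dist (b i) (b j) : ℝ))
    (hNh : N.IsHermitian) :
    (Finset.univ.filter fun i => hNh.eigenvalues i < 0).card = n - 1 ∧
    (Finset.univ.filter fun i => 0 < hNh.eigenvalues i).card = 1 := by
  classical
  obtain ⟨k₀, hk₀⟩ : f ∈ Set.range b := by rw [hb_range]; simp
  have hedge : ∀ k, k ≠ k₀ → b k ∈ T.edgeSet := by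
    intro k hk
    have : b k ∈ T.edgeSet ∪ {f} := hb_range ▸ Set.mem_range_self k
    exact this.resolve_right fun h => hk (hb_inj (h.trans hk₀.symm))
  obtain ⟨p, hp, hpl⟩ := hT.connected.exists_path_of_dist f.out.1 f.out.2
  set s : Finset (Fin n) := univ.erase k₀ with hs
  set P : Finset (Fin n) := s.filter fun k => b k ∈ p.edges with hPdef
  have hPs : P ⊆ s := filter_subset _ _
  have hPcard : #P = T.dist f.out.1 f.out.2 := by
    rw [← hpl, ← p.length_edges, ← List.toFinset_card_of_nodup hp.isTrail.edges_nodup]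
    refine card_bij (fun k _ => b k) (fun k hk => ?_) (fun k _ l _ h => hb_inj h) fun e he => ?_
    · simpa using (mem_filter.1 hk).2
    · have hep : e ∈ p.edges := by simpa using he
      have heT := p.edges_subset_edgeSet hep
      obtain ⟨k, rfl⟩ : e ∈ Set.range b := by rw [hb_range]; exact Or.inl heT
      refine ⟨k, mem_filter.2 ⟨mem_erase.2 ⟨?_, mem_univ k⟩, hep⟩, rfl⟩
      rintro rfl
      exact hf_nonedge (hk₀ ▸ heT)
  have hP2 : 2 ≤ #P := by
    rw [hPcard]
    rw [← f.mk_out_eq] at hf_diag hf_nonedge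
    exact hT.connected.one_lt_dist_of_ne_of_not_adj hf_diag hf_nonedge
  set v : Fin n → ℝ := fun k => N k k₀ with hvdef
  have hdiag : ∀ k, N k k = 0 := fun k => by
    simp [hN, min4PC_self _ fun v => T.dist_self (v := v)]
  have hrow : ∀ k, k ≠ k₀ → N k₀ k = v k := fun k _ => by
    simp [hvdef, hN, min4PC_dist_comm (b k₀) (b k)]
  have hoff : ∀ k l, k ≠ k₀ → l ≠ k₀ → k ≠ l → N k l = 2 := fun k l hk hl hkl => by
    simp [hN, min4PC_dist_of_mem_edgeSet hT (hedge k hk) (hedge l hl) (hb_inj.ne hkl)]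
  have hv : ∀ k ∈ s, v k = #P + 1 - 2 * (if k ∈ P then 1 else 0) := fun k hk => by
    have h := min4PC_dist_edge hT (hedge k (ne_of_mem_erase hk)) hp hpl
    have hkP : k ∈ P ↔ b k ∈ p.edges := by simp [hPdef, hk]
    simp only [hkP, hPcard, ← h, hvdef, hN, of_apply, hk₀]
  have hform := dotProduct_mulVec_bordered hdiag (v := v) (fun _ _ => rfl) hrow hoff
  have hm : (2 : ℝ) ≤ #s := by exact_mod_cast hP2.trans (card_le_card hPs)
  obtain ⟨i, hi, hij⟩ := hNh.exists_eigenvalues_pos_and_neg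
    (w := fun k => if k = k₀ then 0 else 1)
    (y := fun k => if k = k₀ then ∑ l ∈ s, v l else 2 * ((#s : ℝ) - 1))
    (by
      have h1 : ∑ k ∈ s, (if k = k₀ then (0 : ℝ) else 1) = #s := by
        rw [sum_congr rfl fun k hk => if_neg (ne_of_mem_erase hk), sum_const, nsmul_one]
      have h2 : ∑ k ∈ s, (if k = k₀ then (0 : ℝ) else 1) ^ 2 = #s := by
        rw [← h1]; exact sum_congr rfl fun k _ => by split_ifs <;> simp
      rw [hform, h1, h2, if_pos rfl]
      nlinarith)
    (fun x hx0 hyx => by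
      rw [hform]
      refine bordered_form_neg hPs hP2 hv ?_ ?_
      · by_contra! h
        refine hx0 (funext fun k => ?_)
        by_cases hk : k = k₀
        · rw [hk, h.1]; rfl
        · exact h.2 k (mem_erase.2 ⟨hk, mem_univ k⟩)
      · rw [dotProduct, ← add_sum_erase _ _ (mem_univ k₀), if_pos rfl] at hyx
        rw [← hyx, add_comm, mul_sum]
        exact congrArg _ (sum_congr rfl fun k hk => by rw [if_neg (ne_of_mem_erase hk)]))
  constructor
  · have : (univ.filter fun j => hNh.eigenvalues j < 0) = univ.erase i := by
      ext j
      simp only [mem_filter, mem_univ, true_and, mem_erase, and_true]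
      exact ⟨fun h hji => lt_asymm hi (hji ▸ h), hij j⟩
    rw [this]
    simp
  · have : (univ.filter fun j => 0 < hNh.eigenvalues j) = {i} := by
      ext j
      simp only [mem_filter, mem_univ, true_and, mem_singleton]
      exact ⟨fun h => by_contra fun hji => lt_asymm h (hij j hji), fun h => h ▸ hi⟩
    rw [this, card_singleton]
end

section
/- Let T be a tree on n vertices and let V_2 be the set of 2-element subsets of its vertex set. Then there exists a map φ : V_2 → ℝ^{n−1} such that for all {i,j}, {k,l} ∈ V_2, the ℓ₁-distance ‖φ({i,j}) − φ({k,l})‖₁ equals Min4PC_T({i,j},{k,l}); that is, Min4PC_T is isometrically ℓ₁-embeddable in ℝ^{n−1}. -/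
namespace SimpleGraph

variable {V : Type*} {G : SimpleGraph V}

/-- The vertices `u` and `v` lie in different components of `G` once the edge `e` is deleted. -/
def Separates (G : SimpleGraph V) (e : Sym2 V) (u v : V) : Prop :=
  ¬ (G.deleteEdges {e}).Reachable u v

lemma Separates.symm {e : Sym2 V} {u v : V} (h : G.Separates e u v) : G.Separates e v u :=
  fun h' => h h'.symm

lemma separates_comm {e : Sym2 V} {u v : V} : G.Separates e u v ↔ G.Separates e v u :=
  ⟨Separates.symm, Separates.symm⟩

lemma not_separates_trans {e : Sym2 V} {u v w : V} (huv : ¬ G.Separates e u v)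
    (hvw : ¬ G.Separates e v w) : ¬ G.Separates e u w :=
  fun h => h ((not_not.1 huv).trans (not_not.1 hvw))

lemma Separates.mem_edges {e : Sym2 V} {u v : V} (h : G.Separates e u v) (p : G.Walk u v) :
    e ∈ p.edges := by
  by_contra he
  exact h ⟨p.toDeleteEdge e he⟩

/-- Deleting the edge `s(x, y)` leaves every vertex that reaches `x` connected to `x` or `y`. -/
lemma Walk.reachable_deleteEdges_or {x y u : V} (p : G.Walk u x) :
    (G.deleteEdges {s(x, y)}).Reachable u x ∨ (G.deleteEdges {s(x, y)}).Reachable u y := by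
  induction p with
  | nil => exact Or.inl (Reachable.refl _)
  | @cons u v x h p ih =>
    by_cases he : s(u, v) = s(x, y)
    · rcases Sym2.eq_iff.1 he with ⟨rfl, -⟩ | ⟨rfl, -⟩
      · exact Or.inl (Reachable.refl _)
      · exact Or.inr (Reachable.refl _)
    · have hadj : (G.deleteEdges {s(x, y)}).Adj u v := by
        simp only [deleteEdges_adj, Set.mem_singleton_iff]
        exact ⟨h, he⟩
      exact ih.imp hadj.reachable.trans hadj.reachable.trans

/-- Deleting an edge of a connected graph leaves at most two components. -/
lemma Connected.not_separates (hG : G.Connected) {e : Sym2 V} {u v w : V}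
    (huv : G.Separates e u v) (hvw : G.Separates e v w) : ¬ G.Separates e u w := by
  induction e with
  | _ x y =>
    have key (a : V) := (hG.preconnected a x).elim fun p => p.reachable_deleteEdges_or (y := y)
    intro huw
    rcases key u with hu | hu <;> rcases key v with hv | hv <;> rcases key w with hw | hw <;>
      first
      | exact huv (hu.trans hv.symm)
      | exact hvw (hv.trans hw.symm)
      | exact huw (hu.trans hw.symm)

/-- Two edges cannot induce crossing splits of four vertices. -/
lemma not_separates_of_separates {e f : Sym2 V} {i j k l : V} (hij : G.Separates f i j)
    (hkl : G.Separates f k l) (hij' : ¬ G.Separates e i j) (hkl' : ¬ G.Separates e k l) :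
    ¬ G.Separates e i k := by
  induction f with
  | _ x y =>
    have key {a b : V} (h : G.Separates s(x, y) a b) (h' : ¬ G.Separates e a b) :
        (G.deleteEdges {e}).Reachable a x := by
      obtain ⟨p⟩ := not_not.1 h'
      classical
      have hx := h.mem_edges (p.mapLe (deleteEdges_le _))
      rw [Walk.edges_mapLe_eq_edges] at hx
      exact ⟨p.takeUntil x (p.fst_mem_support_of_mem_edges hx)⟩
    exact not_not.2 ((key hij hij').trans (key hkl hkl').symm)

/-- In a connected graph, some pairing of four vertices has no edge separating both pairs. -/
lemma Connected.exists_pairing (hG : G.Connected) (i j k l : V) :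
    (∀ e, ¬ (G.Separates e i j ∧ G.Separates e k l)) ∨
    (∀ e, ¬ (G.Separates e i k ∧ G.Separates e j l)) ∨
    (∀ e, ¬ (G.Separates e i l ∧ G.Separates e j k)) := by
  by_contra! h
  obtain ⟨⟨e, hij, hkl⟩, ⟨f, hik, hjl⟩, ⟨g, hil, hjk⟩⟩ := h
  have heik : G.Separates e i k := by
    by_contra h
    have h' : ¬ G.Separates e j l := fun h' =>
      not_separates_trans (fun hki => h hki.symm) (hG.not_separates hij h') hkl
    exact not_separates_of_separates hik hjl h h' hij
  have heil : ¬ G.Separates e i l := hG.not_separates heik hkl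
  have hejk : ¬ G.Separates e j k := hG.not_separates hij.symm heik
  exact not_separates_of_separates hil hjk heil hejk hij

lemma IsTree.separates_iff (hT : G.IsTree) {e : Sym2 V} {u v : V} {p : G.Walk u v}
    (hp : p.IsPath) : G.Separates e u v ↔ e ∈ p.edges := by
  refine ⟨fun h => h.mem_edges p, fun he hr => ?_⟩
  obtain ⟨q, hq⟩ := hr.exists_isPath
  have hpq : q.mapLe (deleteEdges_le _) = p :=
    congrArg Subtype.val ((hT.isAcyclic.subsingleton_path u v).elim
      ⟨_, hq.mapLe (deleteEdges_le _)⟩ ⟨p, hp⟩)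
  rw [← hpq, Walk.edges_mapLe_eq_edges] at he
  have := q.edges_subset_edgeSet he
  simp at this

open Classical in
/-- Indicator of `G.Separates e u v`. -/
noncomputable def cut (G : SimpleGraph V) (e : Sym2 V) (u v : V) : ℝ :=
  if G.Separates e u v then 1 else 0

lemma IsTree.sum_cut [Fintype G.edgeSet] (hT : G.IsTree) (u v : V) :
    ∑ e ∈ G.edgeFinset, G.cut e u v = G.dist u v := by
  classical
  obtain ⟨p, hp, hlen⟩ := hT.connected.exists_path_of_dist u v
  have hfilter : G.edgeFinset.filter (fun e => G.Separates e u v) = p.edges.toFinset := by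
    ext e
    simp only [Finset.mem_filter, mem_edgeFinset, List.mem_toFinset, hT.separates_iff hp]
    exact ⟨And.right, fun h => ⟨p.edges_subset_edgeSet h, h⟩⟩
  simp only [cut, Finset.sum_boole, hfilter]
  rw [List.toFinset_card_of_nodup hp.isTrail.edges_nodup, Walk.length_edges, hlen]

/-- The three pairings dominate the difference of cut indicators, with equality for a pairing
whose two pairs are not both separated. -/
lemma Connected.abs_cut_sub_cut (hG : G.Connected) (e : Sym2 V) (i j k l : V) :
    (|G.cut e i j - G.cut e k l| ≤ G.cut e i j + G.cut e k l ∧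
      (¬ (G.Separates e i j ∧ G.Separates e k l) →
        |G.cut e i j - G.cut e k l| = G.cut e i j + G.cut e k l)) ∧
    (|G.cut e i j - G.cut e k l| ≤ G.cut e i k + G.cut e j l ∧
      (¬ (G.Separates e i k ∧ G.Separates e j l) →
        |G.cut e i j - G.cut e k l| = G.cut e i k + G.cut e j l)) := by
  have t := fun a b c => @not_separates_trans V G e a b c
  have s := fun a b c => @Connected.not_separates V G hG e a b c
  have c := fun a b => @separates_comm V G e a b
  unfold cut
  split_ifs <;> norm_num <;> grind

lemma IsTree.sum_abs_cut_sub_cut [Fintype G.edgeSet] (hT : G.IsTree) (i j k l : V) :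
    ∑ e ∈ G.edgeFinset, |G.cut e i j - G.cut e k l| =
      min ((G.dist i j : ℝ) + G.dist k l)
        (min ((G.dist i k : ℝ) + G.dist j l) (G.dist i l + G.dist j k)) := by
  have hcomm (e : Sym2 V) : G.cut e l k = G.cut e k l := by
    classical exact if_congr separates_comm rfl rfl
  have h (e : Sym2 V) := hT.connected.abs_cut_sub_cut e i j k l
  have h' (e : Sym2 V) := (hT.connected.abs_cut_sub_cut e i j l k).2
  simp only [hcomm] at h'
  simp only [← hT.sum_cut, ← Finset.sum_add_distrib]
  refine le_antisymm (le_min ?_ (le_min ?_ ?_)) ?_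
  · exact Finset.sum_le_sum fun e _ => (h e).1.1
  · exact Finset.sum_le_sum fun e _ => (h e).2.1
  · exact Finset.sum_le_sum fun e _ => (h' e).1
  · rcases hT.connected.exists_pairing i j k l with hp | hp | hp
    · rw [Finset.sum_congr rfl fun e _ => (h e).1.2 (hp e)]
      exact min_le_left _ _
    · rw [Finset.sum_congr rfl fun e _ => (h e).2.2 (hp e)]
      exact (min_le_right _ _).trans (min_le_left _ _)
    · rw [Finset.sum_congr rfl fun e _ => (h' e).2 (hp e)]
      exact (min_le_right _ _).trans (min_le_right _ _)

end SimpleGraph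

/-- Let `T` be a tree on `n` vertices and `V₂` the set of 2-element subsets of
its vertex set.  Then there is a map `φ : V₂ → ℝ^(n-1)` such that for all `{i,j}, {k,l} ∈ V₂`,
the `ℓ₁`-distance `‖φ({i,j}) - φ({k,l})‖₁ = Σ |·|` equals `Min4PC_T({i,j},{k,l})`; i.e.
`Min4PC_T` is isometrically `ℓ₁`-embeddable in `ℝ^(n-1)`. -/
theorem min4PC_l1_embeddable
    (n : ℕ) (T : SimpleGraph (Fin n)) (hT : T.IsTree) :
    ∃ φ : Sym2 (Fin n) → (Fin (n - 1) → ℝ),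
      ∀ e e' : Sym2 (Fin n), ¬ e.IsDiag → ¬ e'.IsDiag →
        (∑ x : Fin (n - 1), |φ e x - φ e' x|) = (min4PC T.dist e e' : ℝ) := by
  classical
  have hcard : T.edgeFinset.card = n - 1 := by
    have := hT.card_edgeFinset
    rw [Fintype.card_fin] at this
    omega
  refine ⟨fun p x => T.cut ((T.edgeFinset.equivFinOfCardEq hcard).symm x) p.out.1 p.out.2,
    fun p q _ _ => ?_⟩
  rw [Equiv.sum_comp (T.edgeFinset.equivFinOfCardEq hcard).symm
    (fun e => |T.cut e p.out.1 p.out.2 - T.cut e q.out.1 q.out.2|),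
    Finset.sum_coe_sort T.edgeFinset
      (fun e => |T.cut e p.out.1 p.out.2 - T.cut e q.out.1 q.out.2|),
    hT.sum_abs_cut_sub_cut, min4PC]
  push_cast
  rfl
end

section
/- Let T be a tree on n vertices and V_2 the set of 2-element subsets of its vertex set. Then there exists a map φ : V_2 → {0,1}^{n−1} such that for all {i,j}, {k,l} ∈ V_2, the Hamming distance between φ({i,j}) and φ({k,l}) (the number of coordinates where they differ) equals Min4PC_T({i,j},{k,l}); that is, Min4PC_T embeds isometrically into the (n−1)-dimensional hypercube with the Hamming metric. -/
open scoped Classical in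
/-- If `d` counts the members of a family of cuts separating two points, and no two cuts of the
family cross, then the number of cuts separating exactly one of the pairs `i, j` and `k, l` is the
smallest of the three pairing sums. -/
theorem card_xor_separating_eq_min {ι V : Type*} [Fintype ι] (s : ι → V → Prop) (d : V → V → ℕ)
    (hd : ∀ u v, d u v = (Finset.univ.filter fun x => ¬(s x u ↔ s x v)).card)
    (hs : ∀ x y i j k l, (s x i ↔ s x j) → (s x k ↔ s x l) → ¬(s x i ↔ s x k) →
      ¬(s y i ↔ s y j) → (s y k ↔ s y l)) (i j k l : V) :
    (Finset.univ.filter fun x => ¬((s x i ↔ s x j) ↔ (s x k ↔ s x l))).card =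
      min (d i j + d k l) (min (d i k + d j l) (d i l + d j k)) := by
  have sum_le (p q r : ι → Prop)
      [DecidablePred p] [DecidablePred q] [DecidablePred r]
      (h : ∀ x, r x → p x ∨ q x) :
      (Finset.univ.filter r).card ≤
        (Finset.univ.filter p).card + (Finset.univ.filter q).card := by
    refine (Finset.card_le_card ?_).trans (Finset.card_union_le _ _)
    intro x hx
    simpa using h x (by simpa using hx)
  have le_card (p q r : ι → Prop)
      [DecidablePred p] [DecidablePred q] [DecidablePred r]
      (h : ∀ x, ¬(p x ∧ q x)) (h' : ∀ x, p x ∨ q x → r x) :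
      (Finset.univ.filter p).card + (Finset.univ.filter q).card ≤
        (Finset.univ.filter r).card := by
    rw [← Finset.card_union_of_disjoint]
    · refine Finset.card_le_card ?_
      intro x hx
      simpa using h' x (by simpa using hx)
    · rw [Finset.disjoint_filter]
      exact fun x _ hp hq => h x ⟨hp, hq⟩
  simp only [hd]
  apply le_antisymm
  · refine le_min ?_ (le_min ?_ ?_) <;> refine sum_le _ _ _ fun x hx => ?_ <;> tauto
  · by_cases h₁ : ∃ x, (s x i ↔ s x k) ∧ (s x j ↔ s x l) ∧ ¬(s x i ↔ s x j)
    · obtain ⟨x, hik, hjl, hij⟩ := h₁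
      refine (min_le_right _ _).trans ((min_le_left _ _).trans (le_card _ _ _ ?_ ?_))
      · rintro y ⟨hy, hy'⟩
        exact hy' (hs x y i k j l hik hjl hij hy)
      · intro y
        have := hs x y i k j l hik hjl hij
        tauto
    by_cases h₂ : ∃ x, (s x i ↔ s x l) ∧ (s x j ↔ s x k) ∧ ¬(s x i ↔ s x j)
    · obtain ⟨x, hil, hjk, hij⟩ := h₂
      refine (min_le_right _ _).trans ((min_le_right _ _).trans (le_card _ _ _ ?_ ?_))
      · rintro y ⟨hy, hy'⟩
        exact hy' (hs x y i l j k hil hjk hij hy)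
      · intro y
        have := hs x y i l j k hil hjk hij
        tauto
    · refine (min_le_left _ _).trans (le_card _ _ _ ?_ ?_) <;> intro y <;>
        have h₁y := not_exists.mp h₁ y <;> have h₂y := not_exists.mp h₂ y <;> clear hs <;> grind

namespace SimpleGraph

variable {V : Type*} {G : SimpleGraph V}

/-- The vertices on the side of the first endpoint of `e` once `e` is deleted. -/
def edgeSide (G : SimpleGraph V) (e : Sym2 V) (v : V) : Prop :=
  (G.deleteEdges {e}).Reachable v e.out.1

theorem edgeSide_iff_of_adj_of_ne {e : Sym2 V} {u v : V} (h : G.Adj u v) (he : s(u, v) ≠ e) :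
    G.edgeSide e u ↔ G.edgeSide e v := by
  have h' : (G.deleteEdges {e}).Adj u v := by simp [deleteEdges_adj, h, he]
  exact ⟨h'.reachable.symm.trans, h'.reachable.trans⟩

theorem IsAcyclic.not_edgeSide_iff (hG : G.IsAcyclic) {u v : V} (h : G.Adj u v) :
    ¬(G.edgeSide s(u, v) u ↔ G.edgeSide s(u, v) v) := by
  have hb : ¬(G.deleteEdges {s(u, v)}).Reachable u v := by
    have := isAcyclic_iff_forall_adj_isBridge.mp hG h
    simpa [isBridge_iff] using this
  have ho : s((s(u, v)).out.1, (s(u, v)).out.2) = s(u, v) := Quot.out_eq _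
  unfold edgeSide
  rcases Sym2.eq_iff.mp ho with ⟨h₁, -⟩ | ⟨h₁, -⟩ <;> rw [h₁]
  · exact fun hc => hb (hc.mp .rfl).symm
  · exact fun hc => hb (hc.mpr .rfl)

/-- A walk avoiding an edge stays on one side of it. -/
theorem edgeSide_iff_of_notMem_edges {e : Sym2 V} {u v : V} (p : G.Walk u v) (he : e ∉ p.edges) :
    G.edgeSide e u ↔ G.edgeSide e v := by
  induction p with
  | nil => rfl
  | cons h p ih =>
    simp only [Walk.edges_cons, List.mem_cons, not_or] at he
    exact (edgeSide_iff_of_adj_of_ne h (Ne.symm he.1)).trans (ih he.2)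

/-- In an acyclic graph, a trail traverses precisely the edges separating its endpoints. -/
theorem IsAcyclic.mem_edges_iff_not_edgeSide_iff (hG : G.IsAcyclic) {e : Sym2 V} {u v : V}
    {p : G.Walk u v} (hp : p.IsTrail) :
    e ∈ p.edges ↔ ¬(G.edgeSide e u ↔ G.edgeSide e v) := by
  refine ⟨fun he => ?_, fun h => by_contra fun he => h (edgeSide_iff_of_notMem_edges p he)⟩
  induction p with
  | nil => simp at he
  | @cons a b _ h p ih =>
    rw [Walk.isTrail_cons] at hp
    by_cases heq : e = s(a, b)
    · subst heq
      have := edgeSide_iff_of_notMem_edges p hp.2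
      have := hG.not_edgeSide_iff h
      tauto
    · have := edgeSide_iff_of_adj_of_ne h (Ne.symm heq)
      have := ih hp.1 (by simpa [heq] using he)
      tauto

/-- Two vertices on the same side of `e` that are separated by `f` lie on the side of `e`
containing `f`. -/
theorem IsTree.edgeSide_iff_of_separated (hG : G.IsTree) {e : Sym2 V} {c d u v : V}
    (he : G.edgeSide e u ↔ G.edgeSide e v)
    (hf : ¬(G.edgeSide s(c, d) u ↔ G.edgeSide s(c, d) v)) :
    G.edgeSide e u ↔ G.edgeSide e c := by
  classical
  obtain ⟨p, hp, -⟩ := hG.existsUnique_path u v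
  have hfp := (hG.isAcyclic.mem_edges_iff_not_edgeSide_iff hp.isTrail).mpr hf
  have hep : e ∉ p.edges := fun h =>
    (hG.isAcyclic.mem_edges_iff_not_edgeSide_iff hp.isTrail).mp h he
  have hc : c ∈ p.support := p.fst_mem_support_of_mem_edges hfp
  exact edgeSide_iff_of_notMem_edges (p.takeUntil c hc)
    fun h => hep (p.edges_takeUntil_subset_edges hc h)

open scoped Classical in
/-- The distance in a tree is the number of edges separating the two vertices. -/
theorem IsTree.dist_eq_card_separating (hG : G.IsTree) [Fintype G.edgeSet] (u v : V) :
    G.dist u v =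
      (Finset.univ.filter fun e : G.edgeSet => ¬(G.edgeSide e u ↔ G.edgeSide e v)).card := by
  obtain ⟨p, hp, hlen⟩ := hG.connected.exists_path_of_dist u v
  rw [← hlen, ← p.length_edges, ← List.toFinset_card_of_nodup hp.isTrail.edges_nodup,
    ← Finset.card_map (Function.Embedding.subtype _)]
  congr 1
  ext e
  simp only [List.mem_toFinset, Finset.mem_map, Finset.mem_filter, Finset.mem_univ, true_and,
    Function.Embedding.subtype_apply, Subtype.exists, exists_and_right, exists_eq_right,
    ← hG.isAcyclic.mem_edges_iff_not_edgeSide_iff hp.isTrail]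
  exact ⟨fun h => ⟨p.edges_subset_edgeSet h, h⟩, fun ⟨_, h⟩ => h⟩

end SimpleGraph

/-- Let `T` be a tree on `n` vertices and `V₂` the set of 2-element subsets of
its vertex set.  Then there is a map `φ : V₂ → {0,1}^(n-1)` such that for all
`{i,j}, {k,l} ∈ V₂`, the Hamming distance between `φ({i,j})` and `φ({k,l})` equals
`Min4PC_T({i,j},{k,l})`; i.e. `Min4PC_T` embeds isometrically into the `(n-1)`-dimensional
hypercube with the Hamming metric. -/
theorem min4PC_hypercube_embeddable
    (n : ℕ) (T : SimpleGraph (Fin n)) (hT : T.IsTree) :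
    ∃ φ : Sym2 (Fin n) → (Fin (n - 1) → Fin 2),
      ∀ e e' : Sym2 (Fin n), ¬ e.IsDiag → ¬ e'.IsDiag →
        hammingDist (φ e) (φ e') = min4PC T.dist e e' := by
  classical
  have hcard : Fintype.card T.edgeSet = n - 1 := by
    have := hT.card_edgeFinset
    rw [SimpleGraph.edgeFinset_card, Fintype.card_fin] at this
    omega
  let E : T.edgeSet ≃ Fin (n - 1) := Fintype.equivFinOfCardEq hcard
  refine ⟨fun e x => if (T.edgeSide (E.symm x) e.out.1 ↔ T.edgeSide (E.symm x) e.out.2)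
    then 0 else 1, fun e e' _ _ => ?_⟩
  rw [min4PC, ← card_xor_separating_eq_min (fun x : T.edgeSet => T.edgeSide x) T.dist
    hT.dist_eq_card_separating, hammingDist]
  · refine Finset.card_equiv E.symm fun x => ?_
    simp only [Finset.mem_filter, Finset.mem_univ, true_and]
    split_ifs <;> simp_all
  · rintro ⟨e, _⟩ ⟨⟨c, d⟩, _⟩ i j k l hij hkl hik hf
    by_contra hf'
    have := hT.edgeSide_iff_of_separated (c := c) (d := d) hij hf
    have := hT.edgeSide_iff_of_separated (c := c) (d := d) hkl hf'
    tauto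
end

section
/- Let T be a tree on n vertices and V_2 the set of 2-element subsets of its vertex set. Then Min4PC_T satisfies the triangle inequality: for all α, β, γ ∈ V_2, Min4PC_T(α,γ) ≤ Min4PC_T(α,β) + Min4PC_T(β,γ). -/
/-- `min4PC` satisfies the triangle inequality whenever `d` is symmetric and satisfies it. -/
theorem min4PC_triangle_of_metric {V : Type*} {d : V → V → ℕ} (hsymm : ∀ x y, d x y = d y x)
    (htri : ∀ x y z, d x z ≤ d x y + d y z) (α β γ : Sym2 V) :
    min4PC d α γ ≤ min4PC d α β + min4PC d β γ := by
  unfold min4PC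
  generalize α.out.1 = i, α.out.2 = j, β.out.1 = k, β.out.2 = l, γ.out.1 = p, γ.out.2 = q
  have hquad (x y u v : V) : d x y ≤ d x u + d u v + d y v := by
    have := htri x u y
    have := htri u v y
    have := hsymm v y
    omega
  have := hquad i j k l
  have := hquad i j l k
  have := hquad p q k l
  have := hquad p q l k
  have := hsymm l k
  have := hsymm p k
  have := hsymm p l
  have := hsymm q k
  have := hsymm q l
  have := htri i k p
  have := htri i k q
  have := htri i l p
  have := htri i l q
  have := htri j k p
  have := htri j k q
  have := htri j l p
  have := htri j l q
  omega

/-- Let `T` be a tree on `n` vertices and `V₂` the set of 2-element subsets of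
its vertex set.  Then `Min4PC_T` satisfies the triangle inequality: for all `α, β, γ ∈ V₂`,
`Min4PC_T(α,γ) ≤ Min4PC_T(α,β) + Min4PC_T(β,γ)`. -/
theorem min4PC_triangle_inequality
    (n : ℕ) (T : SimpleGraph (Fin n)) (hT : T.IsTree)
    (α β γ : Sym2 (Fin n)) (hα : ¬ α.IsDiag) (hβ : ¬ β.IsDiag) (hγ : ¬ γ.IsDiag) :
    min4PC T.dist α γ ≤ min4PC T.dist α β + min4PC T.dist β γ := by
  exact min4PC_triangle_of_metric (d := T.dist) (fun _ _ => T.dist_comm)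
    (fun _ _ _ => hT.connected.dist_triangle) α β γ
end

section
/- Let T be a tree on n vertices and V_2 the set of 2-element subsets of its vertex set. Then the matrix Min4PC_T is hypermetric: for every integer vector x = (x_α)_{α ∈ V_2} with Σ_α x_α = 1, one has Σ_{α < β} x_α x_β · Min4PC_T(α,β) ≤ 0 (equivalently, xᵀ (Min4PC_T) x ≤ 0, since all diagonal entries of Min4PC_T are zero). -/
namespace SimpleGraph

variable {V : Type*} {G : SimpleGraph V}

/-- After deleting one edge of a connected graph, every vertex is reachable from one of its ends. -/
lemma Connected.reachable_deleteEdges_or (hG : G.Connected) (a b u : V) :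
    (G.deleteEdges {s(a, b)}).Reachable a u ∨ (G.deleteEdges {s(a, b)}).Reachable b u := by
  obtain ⟨p⟩ := hG u a
  induction p with
  | nil => exact .inl .rfl
  | @cons u v w huv p ih =>
    by_cases he : s(u, v) = s(w, b)
    · rcases Sym2.eq_iff.1 he with ⟨rfl, -⟩ | ⟨rfl, -⟩
      · exact .inl .rfl
      · exact .inr .rfl
    · have hvu : (G.deleteEdges {s(w, b)}).Reachable v u :=
        (deleteEdges_adj.2 ⟨huv, he⟩ : (G.deleteEdges {s(w, b)}).Adj u v).symm.reachable
      exact ih.imp (·.trans hvu) (·.trans hvu)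

/-- Vertices joined in `G - g` stay joined in `G - h`, unless they are joined in `G - g` to an
end of `h`. -/
lemma Reachable.deleteEdges_of_not_reachable {g : Sym2 V} {c d i j : V}
    (hij : (G.deleteEdges {g}).Reachable i j) (hic : ¬ (G.deleteEdges {g}).Reachable i c) :
    (G.deleteEdges {s(c, d)}).Reachable i j := by
  classical
  obtain ⟨p⟩ := hij
  by_contra hn
  have hmem := (p.mapLe (G.deleteEdges_le {g})).mem_edges_of_not_reachable_deleteEdges hn
  rw [Walk.edges_mapLe_eq_edges] at hmem
  exact hic ⟨p.takeUntil c (p.fst_mem_support_of_mem_edges hmem)⟩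

/-- The bipartitions of the vertices obtained by deleting single edges are pairwise compatible. -/
lemma reachable_deleteEdges_compatible {g h : Sym2 V} {i j k l : V}
    (hij : (G.deleteEdges {g}).Reachable i j) (hkl : (G.deleteEdges {g}).Reachable k l)
    (hik : ¬ (G.deleteEdges {g}).Reachable i k) :
    (G.deleteEdges {h}).Reachable i j ∨ (G.deleteEdges {h}).Reachable k l := by
  induction h with
  | _ c d =>
    by_cases hic : (G.deleteEdges {g}).Reachable i c
    · exact .inr (hkl.deleteEdges_of_not_reachable fun hkc => hik (hic.trans hkc.symm))
    · exact .inl (hij.deleteEdges_of_not_reachable hic)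

open Classical in
/-- The distance in a tree counts the edges whose deletion separates the two vertices. -/
lemma IsTree.dist_eq_sum_not_reachable [Fintype V] (hG : G.IsTree) (u v : V) :
    G.dist u v = ∑ g : Sym2 V, if (G.deleteEdges {g}).Reachable u v then 0 else 1 := by
  obtain ⟨p, hp, hlen⟩ := hG.connected.exists_path_of_dist u v
  have hiff (g : Sym2 V) : ¬ (G.deleteEdges {g}).Reachable u v ↔ g ∈ p.edges.toFinset := by
    rw [List.mem_toFinset]
    refine ⟨p.mem_edges_of_not_reachable_deleteEdges, fun hg ⟨q⟩ => ?_⟩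
    have hpq : p = q.bypass.mapLe (G.deleteEdges_le {g}) :=
      congrArg Subtype.val <| (hG.isAcyclic.subsingleton_path u v).elim
        ⟨p, hp⟩ ⟨_, q.bypass_isPath.mapLe (G.deleteEdges_le {g})⟩
    rw [hpq, Walk.edges_mapLe_eq_edges] at hg
    simpa [edgeSet_deleteEdges] using Walk.edges_subset_edgeSet _ hg
  rw [← hlen, ← Walk.length_edges, ← List.toFinset_card_of_nodup hp.isTrail.edges_nodup,
    Finset.card_eq_sum_ones]
  simp only [← not_iff_comm.1 (hiff _), ite_not, Finset.sum_ite_mem, Finset.univ_inter]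

/-- The distance of a tree is a sum of cut semimetrics of pairwise compatible bipartitions. -/
lemma IsTree.exists_compatible_cuts [Fintype V] (hG : G.IsTree) :
    ∃ σ : Sym2 V → V → Bool,
      (∀ u v, G.dist u v = ∑ g, if σ g u = σ g v then 0 else 1) ∧
      ∀ g h i j k l, σ g i = σ g j → σ g k = σ g l → σ g i ≠ σ g k →
        σ h i = σ h j ∨ σ h k = σ h l := by
  classical
  have key (g : Sym2 V) : ∃ τ : V → Bool,
      ∀ u v, (G.deleteEdges {g}).Reachable u v ↔ τ u = τ v := by
    induction g with
    | _ a b =>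
      refine ⟨fun u => decide ((G.deleteEdges {s(a, b)}).Reachable a u), fun u v => ?_⟩
      rw [decide_eq_decide]
      refine ⟨fun h => ⟨(·.trans h), (·.trans h.symm)⟩, fun h => ?_⟩
      by_cases hu : (G.deleteEdges {s(a, b)}).Reachable a u
      · exact hu.symm.trans (h.1 hu)
      · exact ((hG.connected.reachable_deleteEdges_or a b u).resolve_left hu).symm.trans
          ((hG.connected.reachable_deleteEdges_or a b v).resolve_left (mt h.2 hu))
  choose σ hσ using key
  refine ⟨σ, fun u v => ?_, fun g h i j k l => ?_⟩
  · simp only [hG.dist_eq_sum_not_reachable, hσ]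
  · simp only [ne_eq, ← hσ]
    exact reachable_deleteEdges_compatible

/-- In a tree, `min4PC` is the Hamming distance between the parities with which the two pairs
cross the cuts. -/
lemma IsTree.exists_min4PC_eq_sum [Fintype V] (hG : G.IsTree) :
    ∃ χ : Sym2 V → Sym2 V → Bool,
      ∀ e f, min4PC G.dist e f = ∑ g, if χ g e = χ g f then 0 else 1 := by
  obtain ⟨σ, hdist, hσ⟩ := hG.exists_compatible_cuts
  refine ⟨fun g e => xor (σ g e.out.1) (σ g e.out.2), fun e f => ?_⟩
  suffices h : ∀ i j k l,
      min (G.dist i j + G.dist k l) (min (G.dist i k + G.dist j l) (G.dist i l + G.dist j k)) =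
        ∑ g, if xor (σ g i) (σ g j) = xor (σ g k) (σ g l) then 0 else 1 from h _ _ _ _
  intro i j k l
  simp only [hdist, ← Finset.sum_add_distrib]
  refine le_antisymm ?_ (le_min ?_ (le_min ?_ ?_))
  · simp only [min_le_iff]
    by_cases h₁ : ∃ g, σ g i = σ g j ∧ σ g k = σ g l ∧ σ g i ≠ σ g k
    · obtain ⟨g, hij, hkl, hik⟩ := h₁
      refine .inl (Finset.sum_le_sum fun h _ => ?_)
      have := hσ g h i j k l hij hkl hik
      generalize σ h i = i, σ h j = j, σ h k = k, σ h l = l at this ⊢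
      decide +revert
    by_cases h₂ : ∃ g, σ g i = σ g k ∧ σ g j = σ g l ∧ σ g i ≠ σ g j
    · obtain ⟨g, hik, hjl, hij⟩ := h₂
      refine .inr (.inl (Finset.sum_le_sum fun h _ => ?_))
      have := hσ g h i k j l hik hjl hij
      generalize σ h i = i, σ h j = j, σ h k = k, σ h l = l at this ⊢
      decide +revert
    · refine .inr (.inr (Finset.sum_le_sum fun h _ => ?_))
      have h₁ := not_exists.1 h₁ h
      have h₂ := not_exists.1 h₂ h
      generalize σ h i = i, σ h j = j, σ h k = k, σ h l = l at h₁ h₂ ⊢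
      decide +revert
  all_goals
    refine Finset.sum_le_sum fun g _ => ?_
    generalize σ g i = i, σ g j = j, σ g k = k, σ g l = l
    decide +revert

end SimpleGraph

/-- Cut semimetrics are hypermetric. -/
lemma sum_mul_mul_cut_nonpos {ι : Type*} [Fintype ι] (x : ι → ℤ) (hx : ∑ α, x α = 1)
    (c : ι → Bool) : ∑ α, ∑ β, x α * x β * (if c α = c β then 0 else 1) ≤ 0 := by
  set A := ∑ α, x α * (c α).toNat with hA
  have hsum : ∑ α, ∑ β, x α * x β * (if c α = c β then 0 else 1) = 2 * (A - A * A) := calc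
    _ = ∑ α, ∑ β, (x α * (c α).toNat * x β + x α * (x β * (c β).toNat)
          - 2 * (x α * (c α).toNat * (x β * (c β).toNat))) := by
      refine Finset.sum_congr rfl fun α _ => Finset.sum_congr rfl fun β _ => ?_
      cases c α <;> cases c β <;> simp [two_mul]
    _ = _ := by
      simp only [Finset.sum_sub_distrib, Finset.sum_add_distrib, ← Finset.mul_sum,
        ← Finset.sum_mul, hx, ← hA]
      ring
  have hAA : A ≤ A * A := by simpa [sq] using Int.le_self_sq A
  linarith

/-- Let `T` be a tree on `n` vertices and `V₂` the set of 2-element subsets of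
its vertex set.  Then the matrix `Min4PC_T` is hypermetric: for every integer vector
`x = (x_α)_{α ∈ V₂}` with `Σ_α x_α = 1`, one has `xᵀ (Min4PC_T) x ≤ 0`
(this quadratic form equals `2 Σ_{α<β} x_α x_β Min4PC_T(α,β)` since the diagonal of
`Min4PC_T` is zero). -/
theorem min4PC_hypermetric
    (n : ℕ) (T : SimpleGraph (Fin n)) (hT : T.IsTree)
    (x : {e : Sym2 (Fin n) // ¬ e.IsDiag} → ℤ)
    (hx : ∑ α, x α = 1) :
    ∑ α, ∑ β, x α * x β * (min4PC T.dist α.1 β.1 : ℤ) ≤ 0 := by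
  obtain ⟨χ, hχ⟩ := hT.exists_min4PC_eq_sum
  calc
    _ = ∑ g, ∑ α, ∑ β, x α * x β * (if χ g α.1 = χ g β.1 then 0 else 1) := by
      simp only [hχ, Nat.cast_sum, Nat.cast_ite, Nat.cast_zero, Nat.cast_one, Finset.mul_sum]
      rw [Finset.sum_comm_cycle]
    _ ≤ 0 := Finset.sum_nonpos fun g _ => sum_mul_mul_cut_nonpos x hx fun α => χ g α.1
end

section
/- Let T be a tree on n vertices and V_2 the set of 2-element subsets of its vertex set. Then the matrix Min4PC_T is of negative type: for every integer vector x = (x_α)_{α ∈ V_2} with Σ_α x_α = 0, one has Σ_{α < β} x_α x_β · Min4PC_T(α,β) ≤ 0 (equivalently, xᵀ (Min4PC_T) x ≤ 0, since all diagonal entries of Min4PC_T are zero). -/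
open scoped symmDiff

/-- If the distance function `d` is the size of the symmetric difference of finite sets `A u`,
and membership in these sets is a laminar family of vertex sets, then the smallest of the three
pairing sums is the size of the fourfold symmetric difference. -/
lemma min_pairings_eq_card_symmDiff {V W : Type*} [DecidableEq W] (d : V → V → ℕ)
    (A : V → Finset W) (hd : ∀ u v, d u v = (A u ∆ A v).card)
    (hA : ∀ w w', (∀ u, w ∈ A u → w' ∈ A u) ∨ (∀ u, w' ∈ A u → w ∈ A u) ∨
      ∀ u, ¬ (w ∈ A u ∧ w' ∈ A u)) (i j k l : V) :
    min (d i j + d k l) (min (d i k + d j l) (d i l + d j k)) =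
      ((A i ∆ A j) ∆ (A k ∆ A l)).card := by
  have card_le (X Y : Finset W) : (X ∆ Y).card ≤ X.card + Y.card :=
    (Finset.card_le_card symmDiff_le_sup).trans
      (Finset.card_union_le X Y)
  have card_eq {X Y : Finset W} (h : Disjoint X Y) : (X ∆ Y).card = X.card + Y.card := by
    rw [h.symmDiff_eq_sup, Finset.sup_eq_union, Finset.card_union_of_disjoint h]
  have swap_middle : (A i ∆ A k) ∆ (A j ∆ A l) = (A i ∆ A j) ∆ (A k ∆ A l) :=
    symmDiff_symmDiff_symmDiff_comm ..
  have swap_last : (A i ∆ A l) ∆ (A j ∆ A k) = (A i ∆ A j) ∆ (A k ∆ A l) := by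
    rw [symmDiff_symmDiff_symmDiff_comm, symmDiff_comm (A l)]
  have some_disjoint : Disjoint (A i ∆ A j) (A k ∆ A l) ∨ Disjoint (A i ∆ A k) (A j ∆ A l) ∨
      Disjoint (A i ∆ A l) (A j ∆ A k) := by
    by_contra! h
    obtain ⟨h₁, h₂, h₃⟩ := h
    obtain ⟨a, ha, ha'⟩ := Finset.not_disjoint_iff.1 h₁
    obtain ⟨b, hb, hb'⟩ := Finset.not_disjoint_iff.1 h₂
    obtain ⟨c, hc, hc'⟩ := Finset.not_disjoint_iff.1 h₃
    rw [Finset.mem_symmDiff] at ha ha' hb hb' hc hc'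
    have hab := hA a b
    have hac := hA a c
    have hbc := hA b c
    grind
  have h₁ := card_le (A i ∆ A j) (A k ∆ A l)
  have h₂ := card_le (A i ∆ A k) (A j ∆ A l)
  have h₃ := card_le (A i ∆ A l) (A j ∆ A k)
  rw [swap_middle] at h₂
  rw [swap_last] at h₃
  simp only [hd]
  rcases some_disjoint with h | h | h
  · have := card_eq h
    omega
  · have := card_eq h
    rw [swap_middle] at this
    omega
  · have := card_eq h
    rw [swap_last] at this
    omega

/-- The Hamming distance between finite sets is of negative type. -/
lemma sum_mul_card_symmDiff_nonpos {ι W : Type*} [Fintype ι] [Fintype W] [DecidableEq W]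
    (P : ι → Finset W) (x : ι → ℤ) (hx : ∑ α, x α = 0) :
    ∑ α, ∑ β, x α * x β * ((P α ∆ P β).card : ℤ) ≤ 0 := by
  let s (w : W) (α : ι) : ℤ := if w ∈ P α then 1 else -1
  have card_eq (α β : ι) : 2 * ((P α ∆ P β).card : ℤ) = ∑ w, (1 - s w α * s w β) := by
    rw [← Finset.filter_univ_mem (P α ∆ P β), Finset.card_filter]
    push_cast
    rw [Finset.mul_sum]
    refine Finset.sum_congr rfl fun w _ => ?_
    by_cases h : w ∈ P α <;> by_cases h' : w ∈ P β <;> simp [s, Finset.mem_symmDiff, h, h']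
  have key : 2 * ∑ α, ∑ β, x α * x β * ((P α ∆ P β).card : ℤ) =
      ∑ w, ((∑ α, x α) ^ 2 - (∑ α, x α * s w α) ^ 2) := by
    calc _ = ∑ α, ∑ β, ∑ w, (x α * x β - (x α * s w α) * (x β * s w β)) := by
          simp only [Finset.mul_sum]
          refine Finset.sum_congr rfl fun α _ => Finset.sum_congr rfl fun β _ => ?_
          rw [mul_left_comm, card_eq, Finset.mul_sum]
          exact Finset.sum_congr rfl fun w _ => by ring
      _ = ∑ w, ∑ α, ∑ β, (x α * x β - (x α * s w α) * (x β * s w β)) := by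
          symm
          rw [Finset.sum_comm]
          exact Finset.sum_congr rfl fun α _ => Finset.sum_comm
      _ = _ := by
          simp only [Finset.sum_sub_distrib, sq, Finset.sum_mul_sum]
  have : 2 * ∑ α, ∑ β, x α * x β * ((P α ∆ P β).card : ℤ) ≤ 0 := by
    rw [key, hx]
    exact Finset.sum_nonpos fun w _ => by nlinarith [sq_nonneg (∑ α, x α * s w α)]
  omega

namespace SimpleGraph.IsTree

variable {V : Type*} {T : SimpleGraph V} (hT : T.IsTree) (r : V)

/-- The path from `r` to `u` in a tree. -/
noncomputable def rootPath (u : V) : T.Path r u :=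
  ⟨_, (hT.existsUnique_path r u).choose_spec.1⟩

lemma rootPath_eq {u : V} (p : T.Walk r u) (hp : p.IsPath) : (hT.rootPath r u).1 = p :=
  (hT.existsUnique_path r u).unique (hT.rootPath r u).2 hp

variable [DecidableEq V]

/-- The vertices of a tree lying between `r` and `u`. -/
noncomputable def ancestors (u : V) : Finset V :=
  (hT.rootPath r u).1.support.toFinset

lemma mem_ancestors_iff {u w : V} :
    w ∈ hT.ancestors r u ↔ w ∈ (hT.rootPath r u).1.support :=
  List.mem_toFinset

lemma mem_ancestors_getVert_iff {u w : V} (i : ℕ) :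
    w ∈ hT.ancestors r ((hT.rootPath r u).1.getVert i) ↔
      w ∈ ((hT.rootPath r u).1.take i).support := by
  rw [mem_ancestors_iff, hT.rootPath_eq r _ ((hT.rootPath r u).2.take i)]

lemma root_mem_ancestors (u : V) : r ∈ hT.ancestors r u :=
  (hT.mem_ancestors_iff r).2 (Walk.start_mem_support _)

lemma exists_getVert_of_mem_ancestors {u w : V} (h : w ∈ hT.ancestors r u) :
    ∃ i ≤ (hT.rootPath r u).1.length, (hT.rootPath r u).1.getVert i = w := by
  obtain ⟨i, hi, hl⟩ := Walk.mem_support_iff_exists_getVert.1 ((hT.mem_ancestors_iff r).1 h)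
  exact ⟨i, hl, hi⟩

lemma ancestors_trans {u v w : V} (hwv : w ∈ hT.ancestors r v) (hvu : v ∈ hT.ancestors r u) :
    w ∈ hT.ancestors r u := by
  obtain ⟨i, -, rfl⟩ := hT.exists_getVert_of_mem_ancestors r hvu
  rw [mem_ancestors_getVert_iff] at hwv
  rw [mem_ancestors_iff]
  exact (Walk.isSubwalk_take _ _).support_subset hwv

lemma getVert_mem_ancestors {u : V} {i j : ℕ} (hij : i ≤ j) :
    (hT.rootPath r u).1.getVert i ∈ hT.ancestors r ((hT.rootPath r u).1.getVert j) := by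
  rw [mem_ancestors_getVert_iff]
  have := ((hT.rootPath r u).1.take j).getVert_mem_support i
  rwa [Walk.take_getVert, min_eq_right hij] at this

lemma ancestors_total {u v w : V} (hv : v ∈ hT.ancestors r u) (hw : w ∈ hT.ancestors r u) :
    v ∈ hT.ancestors r w ∨ w ∈ hT.ancestors r v := by
  obtain ⟨i, -, rfl⟩ := hT.exists_getVert_of_mem_ancestors r hv
  obtain ⟨j, -, rfl⟩ := hT.exists_getVert_of_mem_ancestors r hw
  exact (le_total i j).imp (hT.getVert_mem_ancestors r) (hT.getVert_mem_ancestors r)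

lemma ancestors_antisymm {u v : V} (hv : v ∈ hT.ancestors r u) (hu : u ∈ hT.ancestors r v) :
    u = v := by
  obtain ⟨i, hi, rfl⟩ := hT.exists_getVert_of_mem_ancestors r hv
  rw [mem_ancestors_getVert_iff] at hu
  obtain ⟨j, hj, -⟩ := Walk.mem_support_iff_exists_getVert.1 hu
  rw [Walk.take_getVert, (hT.rootPath r u).2.getVert_eq_end_iff (by omega)] at hj
  rw [show i = (hT.rootPath r u).1.length by omega, Walk.getVert_length]

lemma ancestors_laminar (w w' : V) :
    (∀ u, w ∈ hT.ancestors r u → w' ∈ hT.ancestors r u) ∨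
      (∀ u, w' ∈ hT.ancestors r u → w ∈ hT.ancestors r u) ∨
      ∀ u, ¬ (w ∈ hT.ancestors r u ∧ w' ∈ hT.ancestors r u) := by
  by_contra! h
  obtain ⟨⟨a, ha, ha'⟩, ⟨b, hb, hb'⟩, u, hu, hu'⟩ := h
  rcases hT.ancestors_total r hu hu' with h | h
  · exact hb' (hT.ancestors_trans r h hb)
  · exact ha' (hT.ancestors_trans r h ha)

lemma ancestors_eq_insert {u v : V} (h : T.Adj u v) (hv : v ∉ hT.ancestors r u) :
    hT.ancestors r v = insert v (hT.ancestors r u) := by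
  have hp := (hT.rootPath r u).2.concat ((hT.mem_ancestors_iff r).not.1 hv) h
  ext w
  rw [mem_ancestors_iff, hT.rootPath_eq r _ hp, Walk.support_concat, Finset.mem_insert,
    mem_ancestors_iff]
  simp [or_comm]

lemma card_symmDiff_ancestors_of_adj {u v : V} (h : T.Adj u v) :
    (hT.ancestors r u ∆ hT.ancestors r v).card ≤ 1 := by
  have aux {u v : V} (h : T.Adj u v) (hv : v ∉ hT.ancestors r u) :
      (hT.ancestors r u ∆ hT.ancestors r v).card ≤ 1 := by
    rw [hT.ancestors_eq_insert r h hv]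
    refine (Finset.card_le_card (t := {v}) fun w => ?_).trans_eq (Finset.card_singleton v)
    simp only [Finset.mem_symmDiff, Finset.mem_insert, Finset.mem_singleton]
    tauto
  by_cases hv : v ∈ hT.ancestors r u
  · rw [symmDiff_comm]
    exact aux h.symm fun hu => h.ne (hT.ancestors_antisymm r hv hu)
  · exact aux h hv

lemma card_symmDiff_ancestors_le_length {u v : V} (p : T.Walk u v) :
    (hT.ancestors r u ∆ hT.ancestors r v).card ≤ p.length := by
  induction p with
  | nil => simp
  | @cons a b c h p ih =>
    have hsub : hT.ancestors r a ∆ hT.ancestors r c ⊆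
        hT.ancestors r a ∆ hT.ancestors r b ∪ hT.ancestors r b ∆ hT.ancestors r c :=
      symmDiff_triangle ..
    have := (Finset.card_le_card hsub).trans (Finset.card_union_le _ _)
    have := hT.card_symmDiff_ancestors_of_adj r h
    rw [Walk.length_cons]
    omega

lemma exists_parent {u : V} (hu : u ≠ r) :
    ∃ v, T.Adj v u ∧ u ∉ hT.ancestors r v ∧ hT.ancestors r u = insert u (hT.ancestors r v) := by
  have hnil : ¬ (hT.rootPath r u).1.Nil := Walk.not_nil_of_ne hu.symm
  have hadj := Walk.adj_penultimate hnil
  have hmem : (hT.rootPath r u).1.penultimate ∈ hT.ancestors r u :=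
    (hT.mem_ancestors_iff r).2 (Walk.getVert_mem_support _ _)
  have hnot := fun h => hadj.ne (hT.ancestors_antisymm r hmem h).symm
  exact ⟨_, hadj, hnot, hT.ancestors_eq_insert r hadj hnot⟩

lemma dist_le_card_symmDiff_ancestors (u v : V) :
    T.dist u v ≤ (hT.ancestors r u ∆ hT.ancestors r v).card := by
  induction hm : (hT.ancestors r u).card + (hT.ancestors r v).card using Nat.strong_induction_on
    generalizing u v with
  | _ m ih =>
    subst hm
    have step {u v : V} (hu : u ∉ hT.ancestors r v)
        (ih : ∀ p, (hT.ancestors r p).card < (hT.ancestors r u).card →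
          T.dist p v ≤ (hT.ancestors r p ∆ hT.ancestors r v).card) :
        T.dist u v ≤ (hT.ancestors r u ∆ hT.ancestors r v).card := by
      obtain ⟨p, hadj, hp, heq⟩ := hT.exists_parent r (u := u) fun h =>
        hu (h ▸ hT.root_mem_ancestors r v)
      have hdist := ih p (by rw [heq, Finset.card_insert_of_notMem hp]; omega)
      have hins : hT.ancestors r u ∆ hT.ancestors r v =
          insert u (hT.ancestors r p ∆ hT.ancestors r v) := by
        ext w
        rw [heq]
        simp only [Finset.mem_symmDiff, Finset.mem_insert]
        by_cases hw : w = u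
        · subst hw; tauto
        · tauto
      rw [hins, Finset.card_insert_of_notMem (by simp [Finset.mem_symmDiff, hp, hu])]
      have := hT.connected.dist_triangle (u := u) (v := p) (w := v)
      rw [dist_eq_one_iff_adj.2 hadj.symm] at this
      omega
    by_cases hu : u ∈ hT.ancestors r v
    · by_cases hv : v ∈ hT.ancestors r u
      · simp [hT.ancestors_antisymm r hu hv]
      · rw [dist_comm, symmDiff_comm]
        exact step hv fun p hp => by
          rw [dist_comm, symmDiff_comm]
          exact ih _ (by omega) u p rfl
    · exact step hu fun p hp => ih _ (by omega) p v rfl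

lemma dist_eq_card_symmDiff_ancestors (u v : V) :
    T.dist u v = (hT.ancestors r u ∆ hT.ancestors r v).card := by
  obtain ⟨p, hp⟩ := hT.connected.exists_walk_length_eq_dist u v
  exact (hT.dist_le_card_symmDiff_ancestors r u v).antisymm
    (hp ▸ hT.card_symmDiff_ancestors_le_length r p)

end SimpleGraph.IsTree

/-- Let `T` be a tree on `n` vertices and `V₂` the set of 2-element subsets of
its vertex set.  Then the matrix `Min4PC_T` is of negative type: for every integer vector
`x = (x_α)_{α ∈ V₂}` with `Σ_α x_α = 0`, one has `xᵀ (Min4PC_T) x ≤ 0`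
(this quadratic form equals `2 Σ_{α<β} x_α x_β Min4PC_T(α,β)` since the diagonal of
`Min4PC_T` is zero). -/
theorem min4PC_negativeType
    (n : ℕ) (T : SimpleGraph (Fin n)) (hT : T.IsTree)
    (x : {e : Sym2 (Fin n) // ¬ e.IsDiag} → ℤ)
    (hx : ∑ α, x α = 0) :
    ∑ α, ∑ β, x α * x β * (min4PC T.dist α.1 β.1 : ℤ) ≤ 0 := by
  obtain ⟨r⟩ := hT.connected.nonempty
  let P (α : {e : Sym2 (Fin n) // ¬ e.IsDiag}) : Finset (Fin n) :=
    hT.ancestors r α.1.out.1 ∆ hT.ancestors r α.1.out.2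
  have hP (α β) : min4PC T.dist α.1 β.1 = (P α ∆ P β).card :=
    min_pairings_eq_card_symmDiff T.dist (hT.ancestors r)
      (hT.dist_eq_card_symmDiff_ancestors r) (hT.ancestors_laminar r) ..
  simp only [hP]
  exact sum_mul_card_symmDiff_nonpos P x hx
end

section
/- Let T be a tree on n ≥ 3 vertices and V_2 the set of 2-element subsets of its vertex set. Then the (n choose 2)×(n choose 2) symmetric matrix Min4PC_T has exactly one positive eigenvalue (counted with multiplicity). -/
open Finset
open scoped Matrix

/-- In a connected graph every vertex stays connected to an endpoint of a deleted edge. -/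
theorem SimpleGraph.Walk.reachable_deleteEdges_or_s10 {V : Type*} {G : SimpleGraph V} {a b u : V}
    (p : G.Walk u a) :
    (G.deleteEdges {s(a, b)}).Reachable u a ∨ (G.deleteEdges {s(a, b)}).Reachable u b := by
  induction p with
  | nil => exact Or.inl (SimpleGraph.Reachable.refl _)
  | @cons u w a h p ih =>
    by_cases he : s(u, w) = s(a, b)
    · rcases Sym2.eq_iff.mp he with ⟨rfl, -⟩ | ⟨rfl, -⟩
      · exact Or.inl (SimpleGraph.Reachable.refl _)
      · exact Or.inr (SimpleGraph.Reachable.refl _)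
    · have huw : (G.deleteEdges {s(a, b)}).Reachable u w :=
        SimpleGraph.Adj.reachable (SimpleGraph.deleteEdges_adj.mpr ⟨h, he⟩)
      exact ih.imp huw.trans huw.trans

/-- Deleting an edge of a connected graph leaves at most two components. -/
theorem SimpleGraph.Connected.reachable_deleteEdges_or_s10 {V : Type*} {G : SimpleGraph V}
    (hG : G.Connected) (e : Sym2 V) (u v w : V) :
    (G.deleteEdges {e}).Reachable u v ∨ (G.deleteEdges {e}).Reachable u w ∨
      (G.deleteEdges {e}).Reachable v w := by
  induction e with
  | _ a b =>
    have key (x : V) := (hG.preconnected x a).some.reachable_deleteEdges_or_s10 (b := b)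
    rcases key u with hu | hu <;> rcases key v with hv | hv <;> rcases key w with hw | hw <;>
      first
      | exact Or.inl (hu.trans hv.symm)
      | exact Or.inr (Or.inl (hu.trans hw.symm))
      | exact Or.inr (Or.inr (hv.trans hw.symm))

/-- A component left by deleting `e` that misses an endpoint of `f` stays connected when `f` is
deleted instead. -/
theorem SimpleGraph.Reachable.deleteEdges_of_not_reachable_s10 {V : Type*} {G : SimpleGraph V}
    {e : Sym2 V} {x y u v : V} (huv : (G.deleteEdges {e}).Reachable u v)
    (hux : ¬ (G.deleteEdges {e}).Reachable u x) : (G.deleteEdges {s(x, y)}).Reachable u v := by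
  obtain ⟨q⟩ := huv
  have hx : x ∉ q.support := fun h => hux (by classical exact ⟨q.takeUntil x h⟩)
  have hq : s(x, y) ∉ (q.mapLe (G.deleteEdges_le {e})).edges := by
    rw [SimpleGraph.Walk.edges_mapLe_eq_edges]
    exact fun h => hx (q.fst_mem_support_of_mem_edges h)
  exact ⟨SimpleGraph.Walk.toDeleteEdge _ _ hq⟩

/-- The cuts of a graph given by two edges do not cross. -/
theorem SimpleGraph.reachable_deleteEdges_of_crossing {V : Type*} {G : SimpleGraph V}
    {e f : Sym2 V} {i j k l : V}
    (heik : (G.deleteEdges {e}).Reachable i k) (hejl : (G.deleteEdges {e}).Reachable j l)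
    (heij : ¬ (G.deleteEdges {e}).Reachable i j)
    (hfil : (G.deleteEdges {f}).Reachable i l) (hfjk : (G.deleteEdges {f}).Reachable j k) :
    (G.deleteEdges {f}).Reachable i j := by
  induction f with
  | _ x y =>
    by_cases hix : (G.deleteEdges {e}).Reachable i x
    · have hjx : ¬ (G.deleteEdges {e}).Reachable j x := fun h => heij (hix.trans h.symm)
      exact hfil.trans (hejl.deleteEdges_of_not_reachable_s10 hjx).symm
    · exact (heik.deleteEdges_of_not_reachable_s10 hix).trans hfjk.symm

open Classical in
/-- In a tree, the distance counts the edges whose deletion separates the two vertices. -/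
theorem SimpleGraph.IsTree.dist_eq_card_separating_s10 {V : Type*} [Fintype V] {T : SimpleGraph V}
    (hT : T.IsTree) (u v : V) :
    T.dist u v = #{e : Sym2 V | ¬ (T.deleteEdges {e}).Reachable u v} := by
  obtain ⟨p, hp, hlen⟩ := hT.connected.exists_path_of_dist u v
  rw [← hlen, ← p.length_edges, ← List.toFinset_card_of_nodup hp.edges_nodup]
  congr 1
  ext e
  simp only [List.mem_toFinset, mem_filter, mem_univ, true_and]
  constructor
  · rintro he ⟨q⟩
    have hq := (q.toPath.2.mapLe (T.deleteEdges_le {e}))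
    have hpq : p = _ := congrArg Subtype.val ((hT.isAcyclic.subsingleton_path u v).elim ⟨p, hp⟩ ⟨_, hq⟩)
    rw [hpq, SimpleGraph.Walk.edges_mapLe_eq_edges] at he
    have := SimpleGraph.Walk.edges_subset_edgeSet _ he
    simp at this
  · intro h
    by_contra he
    exact h ⟨SimpleGraph.Walk.toDeleteEdge _ _ he⟩

/-- A tree metric is a sum of pairwise non-crossing cuts. -/
theorem SimpleGraph.IsTree.exists_noncrossing_cuts {V : Type*} [Fintype V] {T : SimpleGraph V}
    (hT : T.IsTree) : ∃ c : Sym2 V → V → Bool,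
      (∀ u v, T.dist u v = ∑ e, if c e u = c e v then 0 else 1) ∧
      ∀ e f i j k l, c e i = c e k → c e j = c e l → c e i ≠ c e j →
        c f i = c f l → c f j = c f k → c f i = c f j := by
  classical
  obtain ⟨r⟩ := hT.connected.nonempty
  have hc (e : Sym2 V) (u v : V) :
      (decide ((T.deleteEdges {e}).Reachable r u) = decide ((T.deleteEdges {e}).Reachable r v)) ↔
        (T.deleteEdges {e}).Reachable u v := by
    rw [decide_eq_decide]
    constructor
    · intro h
      rcases hT.connected.reachable_deleteEdges_or_s10 e r u v with h1 | h1 | h1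
      · exact h1.symm.trans (h.mp h1)
      · exact (h.mpr h1).symm.trans h1
      · exact h1
    · exact fun h => ⟨fun h1 => h1.trans h, fun h1 => h1.trans h.symm⟩
  refine ⟨fun e u => decide ((T.deleteEdges {e}).Reachable r u), fun u v => ?_, ?_⟩
  · rw [hT.dist_eq_card_separating_s10, card_filter]
    refine sum_congr rfl fun e _ => ?_
    simp only [hc, ite_not]
  · intro e f i j k l
    simp only [ne_eq, hc]
    exact SimpleGraph.reachable_deleteEdges_of_crossing

/-- For a sum of non-crossing cuts, the smallest of the three pairings of four points counts the
cuts that separate an odd number of them. -/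
theorem min_pairings_eq_sum_cuts {V E : Type*} [Fintype E] {d : V → V → ℕ} {c : E → V → Bool}
    (hd : ∀ u v, d u v = ∑ e, if c e u = c e v then 0 else 1)
    (hc : ∀ e f i j k l, c e i = c e k → c e j = c e l → c e i ≠ c e j →
      c f i = c f l → c f j = c f k → c f i = c f j) (i j k l : V) :
    min (d i j + d k l) (min (d i k + d j l) (d i l + d j k)) =
      ∑ e, if (c e i = c e j ↔ c e k = c e l) then 0 else 1 := by
  simp only [hd, ← sum_add_distrib]
  apply le_antisymm
  · by_cases h1 : ∃ e, c e i = c e k ∧ c e j = c e l ∧ c e i ≠ c e j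
    · obtain ⟨e, h1, h2, h3⟩ := h1
      refine (min_le_right _ _).trans ((min_le_left _ _).trans (sum_le_sum fun f _ => ?_))
      have h4 := hc e f i j k l h1 h2 h3
      have h5 := hc e f i l k j h1 h2.symm (h2 ▸ h3)
      generalize c f i = a, c f j = b, c f k = p, c f l = q at h4 h5 ⊢
      decide +revert
    by_cases h2 : ∃ e, c e i = c e l ∧ c e j = c e k ∧ c e i ≠ c e j
    · obtain ⟨e, h2, h3, h4⟩ := h2
      refine (min_le_right _ _).trans ((min_le_right _ _).trans (sum_le_sum fun f _ => ?_))
      have h5 := hc e f i j l k h2 h3 h4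
      have h6 := hc e f i k l j h2 h3.symm (h3 ▸ h4)
      generalize c f i = a, c f j = b, c f k = p, c f l = q at h5 h6 ⊢
      decide +revert
    · push Not at h1 h2
      refine (min_le_left _ _).trans (sum_le_sum fun f _ => ?_)
      have h3 := h1 f
      have h4 := h2 f
      generalize c f i = a, c f j = b, c f k = p, c f l = q at h3 h4 ⊢
      decide +revert
  · refine le_min (sum_le_sum fun f _ => ?_)
      (le_min (sum_le_sum fun f _ => ?_) (sum_le_sum fun f _ => ?_)) <;>
    generalize c f i = a, c f j = b, c f k = p, c f l = q <;>
    decide +revert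

/-- The Min4PC matrix of a tree is a Hamming distance matrix. -/
theorem SimpleGraph.IsTree.exists_min4PC_eq_sum_s10 {V : Type*} [Fintype V] {T : SimpleGraph V}
    (hT : T.IsTree) : ∃ g : Sym2 V → Sym2 V → ℝ,
      ∀ α β, (min4PC T.dist α β : ℝ) = ∑ e, (g e α - g e β) ^ 2 := by
  obtain ⟨c, hd, hc⟩ := hT.exists_noncrossing_cuts
  refine ⟨fun e α => if c e α.out.1 = c e α.out.2 then 0 else 1, fun α β => ?_⟩
  rw [min4PC, min_pairings_eq_sum_cuts hd hc]
  push_cast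
  refine sum_congr rfl fun e _ => ?_
  split_ifs <;> simp_all

/-- A matrix of squared Euclidean distances is negative semidefinite on the vectors with
coordinate sum zero. -/
theorem sum_mul_sum_sq_sub_nonpos {ι E : Type*} [Fintype ι] [Fintype E] (g : E → ι → ℝ)
    {x : ι → ℝ} (hx : ∑ α, x α = 0) :
    ∑ α, ∑ β, x α * (∑ e, (g e α - g e β) ^ 2) * x β ≤ 0 := by
  have key (e : E) : ∑ α, ∑ β, x α * (g e α - g e β) ^ 2 * x β =
      -2 * (∑ α, g e α * x α) ^ 2 := by
    have expand (α β : ι) : x α * (g e α - g e β) ^ 2 * x β =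
        (g e α ^ 2 * x α) * x β + x α * (g e β ^ 2 * x β) -
          2 * ((g e α * x α) * (g e β * x β)) := by ring
    simp only [expand, sum_add_distrib, sum_sub_distrib, ← mul_sum, ← sum_mul, hx]
    ring
  calc _ = ∑ e, ∑ α, ∑ β, x α * (g e α - g e β) ^ 2 * x β := by
        rw [sum_comm]
        simp only [mul_sum, sum_mul]
        rw [sum_comm]
        refine (sum_congr rfl fun α _ => sum_comm).trans sum_comm
    _ ≤ 0 := sum_nonpos fun e _ => by rw [key]; nlinarith [sq_nonneg (∑ α, g e α * x α)]

/-- A symmetric matrix that is negative semidefinite on a hyperplane has at most one positive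
eigenvalue. -/
theorem Matrix.IsHermitian.card_pos_eigenvalues_le_one {ι : Type*} [Fintype ι] [DecidableEq ι]
    {M : Matrix ι ι ℝ} (hM : M.IsHermitian) (L : (ι → ℝ) →ₗ[ℝ] ℝ)
    (h : ∀ x, L x = 0 → x ⬝ᵥ (M *ᵥ x) ≤ 0) :
    #{α | 0 < hM.eigenvalues α} ≤ 1 := by
  rw [card_le_one]
  intro α hα β hβ
  simp only [mem_filter, mem_univ, true_and] at hα hβ
  by_contra hne
  set u : ι → ℝ := ⇑(hM.eigenvectorBasis α) with hu
  set v : ι → ℝ := ⇑(hM.eigenvectorBasis β) with hv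
  have inner_eq (γ δ : ι) : ⇑(hM.eigenvectorBasis γ) ⬝ᵥ ⇑(hM.eigenvectorBasis δ) =
      if γ = δ then (1 : ℝ) else 0 := by
    rw [← orthonormal_iff_ite.mp hM.eigenvectorBasis.orthonormal γ δ,
      EuclideanSpace.inner_eq_star_dotProduct, dotProduct_comm]
    simp
  have quad (a b : ℝ) : (a • u + b • v) ⬝ᵥ (M *ᵥ (a • u + b • v)) =
      a ^ 2 * hM.eigenvalues α + b ^ 2 * hM.eigenvalues β := by
    have huv : u ⬝ᵥ v = 0 := by rw [hu, hv, inner_eq, if_neg hne]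
    have hvu : v ⬝ᵥ u = 0 := by rw [dotProduct_comm, huv]
    have huu : u ⬝ᵥ u = 1 := by rw [hu, inner_eq, if_pos rfl]
    have hvv : v ⬝ᵥ v = 1 := by rw [hv, inner_eq, if_pos rfl]
    have hMu : M *ᵥ u = hM.eigenvalues α • u := hM.mulVec_eigenvectorBasis α
    have hMv : M *ᵥ v = hM.eigenvalues β • v := hM.mulVec_eigenvectorBasis β
    simp only [mulVec_add, mulVec_smul, hMu, hMv, dotProduct_add, add_dotProduct,
      dotProduct_smul, smul_dotProduct, huv, hvu, huu, hvv, smul_eq_mul]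
    ring
  by_cases hLu : L u = 0
  · have := h _ hLu
    have := quad 1 0
    simp at this
    linarith
  · have := h (L v • u + (-L u) • v) (by simp; ring)
    rw [quad] at this
    have : 0 < (-L u) ^ 2 * hM.eigenvalues β :=
      mul_pos (by simpa [sq_pos_iff] using hLu) hβ
    have : 0 ≤ (L v) ^ 2 * hM.eigenvalues α := by positivity
    linarith

/-- A nonzero symmetric matrix with nonnegative trace has a positive eigenvalue. -/
theorem Matrix.IsHermitian.exists_pos_eigenvalue {ι : Type*} [Fintype ι] [DecidableEq ι]
    {M : Matrix ι ι ℝ} (hM : M.IsHermitian) (htr : 0 ≤ M.trace) (hne : M ≠ 0) :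
    ∃ α, 0 < hM.eigenvalues α := by
  by_contra! hle
  have hsum : M.trace = ∑ α, hM.eigenvalues α := by simpa using hM.trace_eq_sum_eigenvalues
  refine hne (hM.eigenvalues_eq_zero_iff.mp (funext fun α => ?_))
  exact (sum_eq_zero_iff_of_nonpos fun α _ => hle α).mp
    (le_antisymm (sum_nonpos fun α _ => hle α) (hsum ▸ htr)) α (mem_univ α)

/-- Distinct pairs of vertices of a connected graph, at least one of which is not on the diagonal,
have positive Min4PC value. -/
theorem SimpleGraph.Connected.min4PC_pos {V : Type*} {G : SimpleGraph V} (hG : G.Connected)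
    {α β : Sym2 V} (hα : ¬ α.IsDiag) (hne : α ≠ β) : 0 < min4PC G.dist α β := by
  have eα : s(α.out.1, α.out.2) = α := α.out_eq
  have eβ : s(β.out.1, β.out.2) = β := β.out_eq
  rw [min4PC]
  rw [← eα, Sym2.mk_isDiag_iff] at hα
  have h1 := hG.pos_dist_of_ne hα
  have hd {u v : V} : G.dist u v = 0 → u = v := hG.dist_eq_zero_iff.mp
  have h2 : ¬ (G.dist α.out.1 β.out.1 = 0 ∧ G.dist α.out.2 β.out.2 = 0) := fun h =>
    hne (by rw [← eα, ← eβ, hd h.1, hd h.2])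
  have h3 : ¬ (G.dist α.out.1 β.out.2 = 0 ∧ G.dist α.out.2 β.out.1 = 0) := fun h =>
    hne (by rw [← eα, ← eβ, hd h.1, hd h.2, Sym2.eq_swap])
  omega

/-- Let `T` be a tree on `n ≥ 3` vertices and `V₂` the set of 2-element
subsets of its vertex set.  Then the `(n choose 2) × (n choose 2)` symmetric matrix `Min4PC_T`
(rows and columns indexed by `V₂`) has exactly one positive eigenvalue, counted with
multiplicity. -/
theorem min4PC_one_positive_eigenvalue
    (n : ℕ) (hn : 3 ≤ n) (T : SimpleGraph (Fin n)) (hT : T.IsTree)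
    (M : Matrix {e : Sym2 (Fin n) // ¬ e.IsDiag} {e : Sym2 (Fin n) // ¬ e.IsDiag} ℝ)
    (hM : M = Matrix.of fun α β => (min4PC T.dist α.1 β.1 : ℝ))
    (hMh : M.IsHermitian) :
    (Finset.univ.filter fun α => 0 < hMh.eigenvalues α).card = 1 := by
  obtain ⟨g, hg⟩ := hT.exists_min4PC_eq_sum_s10
  apply le_antisymm
  · refine hMh.card_pos_eigenvalues_le_one (∑ α, LinearMap.proj α) fun x hx => ?_
    have hx0 : ∑ α, x α = 0 := by simpa using hx
    refine le_of_eq_of_le ?_ (sum_mul_sum_sq_sub_nonpos (fun e α => g e α.1) hx0)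
    simp only [hM, dotProduct, Matrix.mulVec, Matrix.of_apply, hg, mul_assoc]
    exact sum_congr rfl fun α _ => mul_sum _ _ _
  · have htr : 0 ≤ M.trace := by
      rw [hM]
      exact sum_nonneg fun α _ => Nat.cast_nonneg _
    have hne : M ≠ 0 := by
      intro h0
      let a : Fin n := ⟨0, by omega⟩
      let b : Fin n := ⟨1, by omega⟩
      let c : Fin n := ⟨2, by omega⟩
      have hab : ¬ s(a, b).IsDiag := by simp [a, b]
      have hac : ¬ s(a, c).IsDiag := by simp [a, c]
      have hpos := hT.connected.min4PC_pos hab (β := s(a, c)) (by simp [a, b, c])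
      have hentry := congrFun (congrFun (hM.symm.trans h0) ⟨_, hab⟩) ⟨_, hac⟩
      simp only [Matrix.of_apply, Matrix.zero_apply, Nat.cast_eq_zero] at hentry
      omega
    obtain ⟨α, hα⟩ := hMh.exists_pos_eigenvalue htr hne
    exact card_pos.mpr ⟨α, by simpa using hα⟩
end
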